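/- Let n ≤ N be natural numbers satisfying one of the following conditions: (n ≥ 6 and N = n), or (n ≥ 10 and N ≤ n+1), or (n ≥ 14 and N ≤ n+3), or (n ≥ 16 and N ≤ n+4), or (n ≥ 18 and N ≤ n+5), or (n ≥ 26 and N ≤ n+6). Then for every N-dimensional subspace F of C(ℝ,ℝ) there exists a non-resonant n-chord diagram (a_i, b_i), i = 1,…,n, such that the subspace {f ∈ F : f(a_i) = f(b_i) for all i = 1,…,n} has dimension at least N − n + 2 (i.e., codimension at most n − 2 in F). -/

import Mathlib

/-- The linear functional `f ↦ f b - f a` on the space `C(ℝ, ℝ)` of continuous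
functions `ℝ → ℝ`. -/
noncomputable def evalDiff (a b : ℝ) : C(ℝ, ℝ) →ₗ[ℝ] ℝ where
  toFun f := f b - f a
  map_add' f g := by simp; ring
  map_smul' c f := by simp [mul_sub]

namespace BorsukUlam

/-- Formal sums modulo 2 of lists of points; a list is an ordered, possibly degenerate simplex and
the empty list is the augmentation simplex. -/
abbrev Chain (V : Type*) := List V →₀ ZMod 2

noncomputable section

variable {V : Type*}

/-- Coning a chain off from the point `b`. -/
def cone (b : V) : Chain V →ₗ[ZMod 2] Chain V := Finsupp.lmapDomain _ _ (List.cons b)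

@[simp] lemma cone_single (b : V) (l : List V) :
    cone b (Finsupp.single l 1) = Finsupp.single (b :: l) 1 := by
  simp [cone]

/-- The boundary modulo 2 of a single ordered simplex. -/
def bdList : List V → Chain V
  | [] => 0
  | b :: l => Finsupp.single l 1 + cone b (bdList l)

/-- The (augmented) simplicial boundary modulo 2. -/
def bd : Chain V →ₗ[ZMod 2] Chain V := Finsupp.linearCombination _ bdList

@[simp] lemma bd_single (l : List V) : bd (Finsupp.single l 1) = bdList l := by simp [bd]

lemma bd_cone (b : V) (c : Chain V) : bd (cone b c) = c + cone b (bd c) := by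
  have : bd ∘ₗ cone b = LinearMap.id + cone b ∘ₗ bd (V := V) := by
    ext1 l
    ext1
    simp [bdList]
  exact LinearMap.congr_fun this c

lemma Chain.add_self (c : Chain V) : c + c = 0 := by
  rw [← two_smul (ZMod 2) c, show (2 : ZMod 2) = 0 from rfl, zero_smul]

lemma bd_bd (c : Chain V) : bd (bd c) = 0 := by
  have : bd ∘ₗ bd (V := V) = 0 := by
    ext1 l
    ext1
    simp only [LinearMap.comp_apply, Finsupp.lsingle_apply, bd_single, LinearMap.zero_apply]
    induction l with
    | nil => simp [bdList]
    | cons b l ih =>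
      rw [bdList, map_add, bd_cone, ih, bd_single, map_zero, add_zero, Chain.add_self]
  exact LinearMap.congr_fun this c

/-- Subdivision of chains of lists of length `n`, with `β l` as the new interior vertex of `l`. -/
def sd (β : List V → V) : ℕ → Chain V →ₗ[ZMod 2] Chain V
  | 0 => LinearMap.id
  | n + 1 => Finsupp.linearCombination _ fun l => cone (β l) (sd β n (bdList l))

lemma sd_succ_single (β : List V → V) (n : ℕ) (l : List V) :
    sd β (n + 1) (Finsupp.single l 1) = cone (β l) (sd β n (bdList l)) := by
  simp [sd]

lemma bd_sd (β : List V → V) (n : ℕ) (c : Chain V) :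
    bd (sd β (n + 1) c) = sd β n (bd c) := by
  suffices bd ∘ₗ sd β (n + 1) = sd β n ∘ₗ bd from LinearMap.congr_fun this c
  induction n with
  | zero =>
    ext1 l
    ext1
    simp only [LinearMap.comp_apply, Finsupp.lsingle_apply, sd_succ_single, bd_cone, bd_single]
    simp [sd, ← bd_single, bd_bd]
  | succ n ih =>
    ext1 l
    ext1
    simp only [LinearMap.comp_apply, Finsupp.lsingle_apply, sd_succ_single β (n + 1), bd_cone,
      bd_single]
    have := LinearMap.congr_fun ih (bdList l)
    simp only [LinearMap.comp_apply] at this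
    rw [this, ← bd_single l, bd_bd, map_zero, map_zero, add_zero]

lemma bd_sd_iterate (β : List V → V) (n r : ℕ) (c : Chain V) :
    bd ((sd β (n + 1))^[r] c) = (sd β n)^[r] (bd c) :=
  Function.Semiconj.iterate_right (f := bd) (fun c => bd_sd β n c) r c

/-- The antipodal map on chains. -/
def anti [Neg V] : Chain V →ₗ[ZMod 2] Chain V := Finsupp.lmapDomain _ _ (List.map Neg.neg)

@[simp] lemma anti_single [Neg V] (l : List V) :
    anti (Finsupp.single l 1) = Finsupp.single (l.map Neg.neg) 1 := by
  simp [anti]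

lemma anti_cone [Neg V] (b : V) (c : Chain V) : anti (cone b c) = cone (-b) (anti c) := by
  suffices anti ∘ₗ cone b = cone (-b) ∘ₗ anti (V := V) from LinearMap.congr_fun this c
  ext1 l
  ext1
  simp

lemma anti_anti [InvolutiveNeg V] (c : Chain V) : anti (anti c) = c := by
  suffices anti ∘ₗ anti (V := V) = LinearMap.id from LinearMap.congr_fun this c
  ext1 l
  ext1
  simp

lemma anti_bdList [Neg V] (l : List V) : anti (bdList l) = bdList (l.map Neg.neg) := by
  induction l with
  | nil => simp [bdList]
  | cons b l ih => simp [bdList, anti_cone, ih]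

lemma anti_bd [Neg V] (c : Chain V) : anti (bd c) = bd (anti c) := by
  suffices anti ∘ₗ bd (V := V) = bd ∘ₗ anti from LinearMap.congr_fun this c
  ext1 l
  ext1
  simp [anti_bdList]

lemma anti_sd [Neg V] (β : List V → V) (hβ : ∀ l : List V, β (l.map Neg.neg) = -β l) (n : ℕ)
    (c : Chain V) : anti (sd β n c) = sd β n (anti c) := by
  induction n generalizing c with
  | zero => rfl
  | succ n ih =>
    suffices anti ∘ₗ sd β (n + 1) = sd β (n + 1) ∘ₗ anti from LinearMap.congr_fun this c
    ext1 l
    ext1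
    simp [sd_succ_single, anti_cone, ih, anti_bdList, hβ]

lemma anti_sd_iterate [Neg V] (β : List V → V) (hβ : ∀ l : List V, β (l.map Neg.neg) = -β l)
    (n r : ℕ) (c : Chain V) : anti ((sd β n)^[r] c) = (sd β n)^[r] (anti c) :=
  Function.Semiconj.iterate_right (f := anti) (fun c => anti_sd β hβ n c) r c

/-- The boundary of the cross-polytope on `e 0, …, e (k - 1)`. -/
def cross [Neg V] (e : ℕ → V) : ℕ → Chain V
  | 0 => Finsupp.single [] 1
  | k + 1 => cone (e k) (cross e k) + anti (cone (e k) (cross e k))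

lemma anti_cross [InvolutiveNeg V] (e : ℕ → V) (k : ℕ) : anti (cross e k) = cross e k := by
  cases k with
  | zero => simp [cross]
  | succ k => simp [cross, anti_anti, add_comm]

lemma bd_cross [InvolutiveNeg V] (e : ℕ → V) (k : ℕ) : bd (cross e k) = 0 := by
  induction k with
  | zero => simp [cross, bdList]
  | succ k ih =>
    rw [cross, map_add, ← anti_bd, bd_cone, ih, map_zero, add_zero, anti_cross, Chain.add_self]

/-- The indicator, modulo 2, of `s` being alternating with first entry `b`. -/
def alt : Bool → List Bool → ZMod 2
  | _, [] => 1
  | b, a :: s => if a = b then alt (!b) s else 0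

/-- The lists obtained from a list by deleting one entry. -/
def dels {α : Type*} : List α → List (List α)
  | [] => []
  | a :: l => l :: (dels l).map (List.cons a)

lemma sum_alt_dels (b : Bool) (s : List Bool) :
    ((dels s).map (alt b)).sum = alt b s + alt (!b) s := by
  induction s generalizing b with
  | nil => cases b <;> rfl
  | cons a s ih =>
    by_cases h : a = b
    · subst h
      have : alt a ∘ List.cons a = alt (!a) := by ext t; simp [alt]
      have h2 : ∀ x : ZMod 2, x + x = 0 := by decide
      simp only [dels, List.map_cons, List.map_map, List.sum_cons, this, ih, alt]
      cases a
      all_goals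
        simp only [Bool.not_true, Bool.not_false, reduceCtorEq, if_true, if_false]
        rw [add_left_comm, h2, add_zero]
    · have : alt b ∘ List.cons a = fun _ => 0 := by ext t; simp [alt, h]
      have h' : a = !b := by cases a <;> cases b <;> simp_all
      subst h'
      simp [dels, this, alt]

lemma map_dels {α β : Type*} (f : α → β) (l : List α) :
    (dels l).map (List.map f) = dels (l.map f) := by
  induction l with
  | nil => rfl
  | cons a l ih => simp [dels, ← ih, Function.comp_def]

lemma sublist_of_mem_dels {α : Type*} {l t : List α} (h : t ∈ dels l) : t.Sublist l := by
  induction l generalizing t with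
  | nil => simp [dels] at h
  | cons a l ih =>
    simp only [dels, List.mem_cons, List.mem_map] at h
    rcases h with rfl | ⟨t, ht, rfl⟩
    · exact List.sublist_cons_self _ _
    · exact (ih ht).cons_cons _

lemma sum_dels_perm {α : Type*} {l l' : List α} (h : l.Perm l') (g : List α → ZMod 2)
    (hg : ∀ s t : List α, s.Perm t → g s = g t) :
    ((dels l).map g).sum = ((dels l').map g).sum := by
  induction h generalizing g with
  | nil => rfl
  | cons x h ih =>
    have := ih (g ∘ List.cons x) fun s t hst => hg _ _ (hst.cons x)
    simp [dels, hg _ _ h, this]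
  | swap x y l =>
    have : g ∘ List.cons x ∘ List.cons y = g ∘ List.cons y ∘ List.cons x := by
      ext t; exact hg _ _ (List.Perm.swap y x t)
    simp [dels, this, add_left_comm]
  | trans _ _ ih₁ ih₂ => rw [ih₁ g hg, ih₂ g hg]

/-- Whether a label is odd. -/
def par (n : ℕ) : Bool := n % 2 = 1

/-- The indicator, modulo 2, of the parities of the labels `c`, sorted increasingly, being
alternating with first entry `b`. -/
def altCode (b : Bool) (c : List ℕ) : ZMod 2 := alt b ((c.mergeSort (· ≤ ·)).map par)

lemma sort_eq_of_perm {c c' : List ℕ} (h : c.Perm c') (hc' : c'.Pairwise (· ≤ ·)) :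
    c.mergeSort (· ≤ ·) = c' := by
  refine List.Perm.eq_of_pairwise (le := (· ≤ ·)) (fun a b _ _ => le_antisymm) ?_ hc'
    ((List.mergeSort_perm c _).trans h)
  have := List.pairwise_mergeSort (le := fun a b : ℕ => decide (a ≤ b))
    (by simp; intro a b c; exact le_trans) (by simp; intro a b; exact le_total a b) c
  simpa using this

lemma pairwise_sort (c : List ℕ) : (c.mergeSort (· ≤ ·)).Pairwise (· ≤ ·) := by
  have := List.pairwise_mergeSort (le := fun a b : ℕ => decide (a ≤ b))
    (by simp; intro a b c; exact le_trans) (by simp; intro a b; exact le_total a b) c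
  simpa using this

lemma sum_altCode_dels (b : Bool) (c : List ℕ) :
    ((dels c).map (altCode b)).sum = altCode b c + altCode (!b) c := by
  have hperm := List.mergeSort_perm c (· ≤ ·)
  rw [sum_dels_perm hperm.symm]
  · rw [altCode, altCode, ← sum_alt_dels, ← map_dels, List.map_map]
    congr 1
    refine List.map_congr_left fun t ht => ?_
    rw [altCode, sort_eq_of_perm (List.Perm.refl t)
      ((pairwise_sort c).sublist (sublist_of_mem_dels ht)), Function.comp]
  · intro s t hst
    rw [altCode, altCode, sort_eq_of_perm (hst.trans (List.mergeSort_perm t _).symm)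
      (pairwise_sort t)]

/-- The involution exchanging the labels `2 i` and `2 i + 1`. -/
def flipLabel (n : ℕ) : ℕ := if n % 2 = 0 then n + 1 else n - 1

lemma alt_map_not (b : Bool) (s : List Bool) : alt b (s.map not) = alt (!b) s := by
  induction s generalizing b with
  | nil => rfl
  | cons a s ih => cases a <;> cases b <;> simp [alt, ih]

lemma altCode_map_flip (b : Bool) (c : List ℕ) (hc : ∀ x ∈ c, ∀ y ∈ c, y ≠ flipLabel x) :
    altCode b (c.map flipLabel) = altCode (!b) c := by
  have hperm := List.mergeSort_perm c (· ≤ ·)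
  rw [altCode, altCode, ← alt_map_not, sort_eq_of_perm (hperm.symm.map flipLabel), List.map_map,
    List.map_map]
  · congr 2
    ext n
    simp only [Function.comp, par, flipLabel]
    grind
  · rw [List.pairwise_map]
    refine (pairwise_sort c).imp_of_mem fun {x y} hx hy hxy => ?_
    have := hc x (hperm.mem_iff.1 hx) y (hperm.mem_iff.1 hy)
    unfold flipLabel at *
    grind

lemma length_le_of_alt {m : ℕ} (b : Bool) (c : List ℕ) (hs : c.Pairwise (· ≤ ·))
    (hc : ∀ x ∈ c, ∀ y ∈ c, y ≠ flipLabel x) (halt : alt b (c.map par) ≠ 0) (k : ℕ)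
    (hk : ∀ x ∈ c, k ≤ x / 2 ∧ x / 2 < m) (hkm : k ≤ m) : c.length + k ≤ m := by
  induction c generalizing b k with
  | nil => simpa using hkm
  | cons x l ih =>
    have hxk := hk x (by simp)
    have hpx : par x = b := by
      by_contra h
      simp [alt, h] at halt
    have halt' : alt (!b) (l.map par) ≠ 0 := by simpa [alt, hpx] using halt
    have key : ∀ z ∈ l, x / 2 + 1 ≤ z / 2 := by
      cases l with
      | nil => simp
      | cons y l =>
        have hpy : par y = !b := by
          by_contra h
          simp [alt, h] at halt'
        have hxy : x ≤ y := by simp at hs; exact hs.1.1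
        have hne := hc x (by simp) y (by simp)
        have h1 : x / 2 + 1 ≤ y / 2 := by
          subst hpx
          unfold par at hpy
          unfold flipLabel at hne
          grind
        intro z hz
        have : y ≤ z := by
          simp only [List.pairwise_cons] at hs
          rcases List.mem_cons.1 hz with rfl | hz
          · exact le_rfl
          · exact hs.2.1 z hz
        omega
    have := ih (!b) (List.pairwise_cons.1 hs).2
      (fun u hu v hv => hc u (List.mem_cons_of_mem _ hu) v (List.mem_cons_of_mem _ hv)) halt'
      (x / 2 + 1) (fun z hz => ⟨key z hz, (hk z (List.mem_cons_of_mem _ hz)).2⟩) (by omega)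
    simp only [List.length_cons]
    omega

/-- The number, modulo 2, of simplices of a chain whose labels alternate, starting with sign `b`. -/
def altCount (code : V → ℕ) (b : Bool) : Chain V →ₗ[ZMod 2] ZMod 2 :=
  Finsupp.linearCombination _ fun l => altCode b (l.map code)

@[simp] lemma altCount_single (code : V → ℕ) (b : Bool) (l : List V) :
    altCount code b (Finsupp.single l 1) = altCode b (l.map code) := by
  simp [altCount]

lemma altCount_bdList (code : V → ℕ) (b : Bool) (l : List V) :
    altCount code b (bdList l) = altCode b (l.map code) + altCode (!b) (l.map code) := by
  have hdel : ∀ (φ : Chain V →ₗ[ZMod 2] ZMod 2) (l : List V),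
      φ (bdList l) = ((dels l).map fun t => φ (Finsupp.single t 1)).sum := by
    intro φ l
    induction l generalizing φ with
    | nil => simp [bdList, dels]
    | cons a l ih =>
      have := ih (φ ∘ₗ cone a)
      simp only [LinearMap.comp_apply, cone_single] at this
      simp [bdList, dels, this, Function.comp_def]
  rw [hdel, ← sum_altCode_dels, ← map_dels, List.map_map]
  simp [Function.comp_def]

/-- Lists without a complementary pair of labels. -/
def noncompl (code : V → ℕ) : Submodule (ZMod 2) (Chain V) :=
  Finsupp.supported _ _ {l : List V | ∀ x ∈ l, ∀ y ∈ l, code y ≠ flipLabel (code x)}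

lemma altCount_bd [Neg V] (code : V → ℕ) (b : Bool) (c : Chain V)
    (hc : c ∈ noncompl code)
    (hcode : ∀ l ∈ c.support, ∀ x ∈ l, code (-x) = flipLabel (code x)) :
    altCount code b (bd c) = altCount code b c + altCount code b (anti c) := by
  rw [← Finsupp.sum_single c, Finsupp.sum]
  simp only [map_sum, ← Finset.sum_add_distrib]
  refine Finset.sum_congr rfl fun l hl => ?_
  have h1 : c l = 1 := by
    have := Finsupp.mem_support_iff.1 hl
    revert this
    generalize c l = a
    revert a
    decide
  rw [h1, bd_single, anti_single, altCount_bdList, altCount_single, altCount_single]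
  congr 1
  rw [← altCode_map_flip]
  · congr 1
    simp only [List.map_map]
    exact List.map_congr_left fun x hx => (hcode l hl x hx).symm
  · have := (Finsupp.mem_supported _ _).1 hc hl
    simpa using this

end

noncomputable section

variable {V : Type*}

lemma map_mem_of_mem_supported {M : Type*} [AddCommGroup M] [Module (ZMod 2) M]
    (φ : Chain V →ₗ[ZMod 2] M) {s : Set (List V)} {P : Submodule (ZMod 2) M}
    (h : ∀ l ∈ s, φ (Finsupp.single l 1) ∈ P) {c : Chain V}
    (hc : c ∈ Finsupp.supported (ZMod 2) (ZMod 2) s) : φ c ∈ P := by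
  rw [Finsupp.supported_eq_span_single] at hc
  have : Submodule.span (ZMod 2) ((fun i => Finsupp.single i (1 : ZMod 2)) '' s) ≤ P.comap φ := by
    rw [Submodule.span_le]
    rintro _ ⟨l, hl, rfl⟩
    exact h l hl
  exact this hc

lemma bdList_mem (l : List V) : bdList l ∈ Finsupp.supported (ZMod 2) (ZMod 2)
    {t : List V | t.length + 1 = l.length ∧ ∀ x ∈ t, x ∈ l} := by
  induction l with
  | nil => simp [bdList]
  | cons b l ih =>
    refine add_mem (Finsupp.single_mem_supported _ _ ?_) ?_
    · simp +contextual
    · refine map_mem_of_mem_supported _ (fun t ht => ?_) ih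
      rw [cone_single]
      refine Finsupp.single_mem_supported _ _ ?_
      simp only [Set.mem_ofPred_eq, List.length_cons, List.mem_cons] at ht ⊢
      grind

section Mesh

variable {E : Type*} [NormedAddCommGroup E] [NormedSpace ℝ E]

/-- The barycentre of a list of points. -/
def bary (l : List E) : E := (l.length : ℝ)⁻¹ • l.sum

lemma bary_map_neg (l : List E) : bary (l.map Neg.neg) = -bary l := by
  have : (l.map Neg.neg).sum = -l.sum := by
    induction l with
    | nil => simp
    | cons a l ih => simp [ih, add_comm]
  simp [bary, this]

lemma bary_mem {K : Set E} (hK : Convex ℝ K) {l : List E} (hl : l ≠ []) (h : ∀ x ∈ l, x ∈ K) :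
    bary l ∈ K := by
  have hpos : (l.length : ℝ) ≠ 0 := by simpa using hl
  have := hK.sum_mem (t := Finset.univ) (w := fun _ : Fin l.length => (l.length : ℝ)⁻¹)
    (z := fun i => l[(i : ℕ)]) (fun _ _ => by positivity) (by simp [hpos])
    (fun i _ => h _ (by simp))
  rwa [← Finset.smul_sum, Fin.sum_univ_getElem] at this

lemma dist_bary_le {D : ℝ} {m : ℕ} {l : List E} (hlen : l.length ≤ m + 1) {x : E} (hx : x ∈ l)
    (h : ∀ y ∈ l, dist y x ≤ D) : dist (bary l) x ≤ m / (m + 1) * D := by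
  obtain ⟨t, ht⟩ : ∃ t, l.Perm (x :: t) := by
    classical
    exact ⟨l.erase x, List.perm_cons_erase hx⟩
  have hD : 0 ≤ D := by simpa using h x hx
  have hn : l.length = t.length + 1 := by simpa using ht.length_eq
  have hb : bary l - x = ((t.length : ℝ) + 1)⁻¹ • (t.map fun y => y - x).sum := by
    have h1 : (t.map fun y => y - x).sum = t.sum - (t.length : ℝ) • x := by
      clear ht hn
      induction t with
      | nil => simp
      | cons a t ih =>
        simp only [List.map_cons, List.sum_cons, List.length_cons, Nat.cast_add, Nat.cast_one,
          add_smul, one_smul, ih]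
        abel
    have h2 : ((t.length : ℝ) + 1) ≠ 0 := by positivity
    rw [bary, ht.sum_eq, hn, h1, List.sum_cons]
    push_cast
    match_scalars <;> field_simp
    ring
  have hsum : ‖(t.map fun y => y - x).sum‖ ≤ t.length * D := by
    have h' : ∀ y ∈ t, dist y x ≤ D := fun y hy => h y (ht.mem_iff.2 (by simp [hy]))
    clear hb hn ht
    induction t with
    | nil => simp
    | cons a t ih =>
      have h3 := ih fun y hy => h' y (by simp [hy])
      have h4 := h' a (by simp)
      rw [dist_eq_norm] at h4
      simp only [List.map_cons, List.sum_cons, List.length_cons, Nat.cast_add, Nat.cast_one]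
      linarith [norm_add_le (a - x) (t.map fun y => y - x).sum]
  rw [dist_eq_norm, hb, norm_smul, norm_inv, Real.norm_of_nonneg (by positivity)]
  have htm : (t.length : ℝ) ≤ m := by exact_mod_cast (by omega : t.length ≤ m)
  calc ((t.length : ℝ) + 1)⁻¹ * ‖(t.map fun y => y - x).sum‖
      ≤ ((t.length : ℝ) + 1)⁻¹ * (t.length * D) := by gcongr
    _ = (t.length / (t.length + 1)) * D := by ring
    _ ≤ m / (m + 1) * D := by
      refine mul_le_mul_of_nonneg_right ?_ hD
      rw [div_le_div_iff₀ (by positivity) (by positivity)]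
      nlinarith

/-- Lists of `n` points of `K` with pairwise distances at most `D`. -/
def smallLists (n : ℕ) (K : Set E) (D : ℝ) : Set (List E) :=
  {l | l.length = n ∧ (∀ x ∈ l, x ∈ K) ∧ ∀ x ∈ l, ∀ y ∈ l, dist x y ≤ D}

lemma sd_mem_supported_smallLists {m n : ℕ} (hn : n ≤ m + 1) {K : Set E} (hK : Convex ℝ K) {D : ℝ}
    (hD : 0 ≤ D) {c : Chain E}
    (hc : c ∈ Finsupp.supported (ZMod 2) (ZMod 2) (smallLists n K D)) :
    sd bary n c ∈ Finsupp.supported (ZMod 2) (ZMod 2) (smallLists n K (m / (m + 1) * D)) := by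
  induction n generalizing K c with
  | zero =>
    refine Finsupp.supported_mono ?_ hc
    rintro l ⟨h1, -⟩
    obtain rfl := List.length_eq_zero_iff.1 h1
    exact ⟨rfl, by simp, by simp⟩
  | succ n ih =>
    refine map_mem_of_mem_supported _ (fun l hl => ?_) hc
    obtain ⟨h1, h2, h3⟩ := hl
    have hne : l ≠ [] := by rintro rfl; simp at h1
    have hb : ∀ x ∈ l, dist (bary l) x ≤ m / (m + 1) * D := fun x hx =>
      dist_bary_le (h1.trans_le hn) hx fun y hy => h3 y hy x hx
    have hbd : bdList l ∈ Finsupp.supported (ZMod 2) (ZMod 2)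
        (smallLists n (K ∩ Metric.closedBall (bary l) (m / (m + 1) * D)) D) := by
      refine Finsupp.supported_mono ?_ (bdList_mem l)
      rintro t ⟨ht1, ht2⟩
      refine ⟨by omega, fun x hx => ⟨h2 x (ht2 x hx), ?_⟩, fun x hx y hy =>
        h3 x (ht2 x hx) y (ht2 y hy)⟩
      rw [Metric.mem_closedBall, dist_comm]
      exact hb x (ht2 x hx)
    rw [sd_succ_single]
    refine map_mem_of_mem_supported _ (fun t ht => ?_)
      (ih (by omega) (hK.inter (convex_closedBall _ _)) hbd)
    obtain ⟨ht1, ht2, ht3⟩ := ht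
    rw [cone_single]
    refine Finsupp.single_mem_supported _ _ ⟨by simp [ht1], ?_, ?_⟩
    · intro x hx
      rcases List.mem_cons.1 hx with rfl | hx
      exacts [bary_mem hK hne h2, (ht2 x hx).1]
    · intro x hx y hy
      rcases List.mem_cons.1 hx with rfl | hx <;> rcases List.mem_cons.1 hy with rfl | hy
      · rw [dist_self]; positivity
      · exact (dist_comm _ _).trans_le (ht2 y hy).2
      · exact (ht2 x hx).2
      · exact ht3 x hx y hy

lemma sd_iterate_mem_supported {ι : Type*} {m n : ℕ} (hn : n ≤ m + 1) (K : ι → Set E)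
    (hK : ∀ i, Convex ℝ (K i)) {D : ℝ} (hD : 0 ≤ D) (r : ℕ) {c : Chain E}
    (hc : c ∈ Finsupp.supported (ZMod 2) (ZMod 2) (⋃ i, smallLists n (K i) D)) :
    (sd bary n)^[r] c ∈ Finsupp.supported (ZMod 2) (ZMod 2)
      (⋃ i, smallLists n (K i) ((m / (m + 1)) ^ r * D)) := by
  induction r with
  | zero => simpa using hc
  | succ r ih =>
    rw [Function.iterate_succ_apply']
    refine map_mem_of_mem_supported _ (fun l hl => ?_) ih
    obtain ⟨i, hi⟩ := Set.mem_iUnion.1 hl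
    refine Finsupp.supported_mono (Set.subset_iUnion_of_subset i ?_)
      (sd_mem_supported_smallLists hn (hK i) (by positivity)
        (Finsupp.single_mem_supported _ _ hi))
    rw [← mul_assoc, ← pow_succ']

end Mesh
end

noncomputable section

section Cube

variable {m : ℕ}

/-- The facet of the cross-polytope with sign vector `ε` (for `ε` with values `±1`). -/
def facet (ε : Fin (m + 1) → ℝ) : Set (Fin (m + 1) → ℝ) :=
  {x | ∑ i, ε i * x i = 1 ∧ ∀ i, |x i| ≤ 1}

lemma convex_facet (ε : Fin (m + 1) → ℝ) : Convex ℝ (facet ε) := by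
  rintro x ⟨hx, hx'⟩ y ⟨hy, hy'⟩ a b ha hb hab
  refine ⟨?_, fun i => ?_⟩
  · have : ∀ i, ε i * (a • x + b • y) i = a * (ε i * x i) + b * (ε i * y i) := by
      intro i; simp; ring
    simp only [this, Finset.sum_add_distrib, ← Finset.mul_sum, hx, hy, mul_one, hab]
  · have h1 := abs_le.1 (hx' i)
    have h2 := abs_le.1 (hy' i)
    simp only [Pi.add_apply, Pi.smul_apply, smul_eq_mul]
    rw [abs_le]
    constructor <;> nlinarith

/-- The vertices of the cross-polytope. -/
def vertex (m k : ℕ) : Fin (m + 1) → ℝ := fun i => if (i : ℕ) = k then 1 else 0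

/-- Sign vectors. -/
abbrev Signs (m : ℕ) := {ε : Fin (m + 1) → ℝ // ∀ i, |ε i| = 1}

lemma facet_subset (ε : Signs m) : facet (ε : Fin (m + 1) → ℝ) ⊆
    {x | ‖x‖ ≤ 1 ∧ 1 ≤ (m + 1) * ‖x‖} := by
  rintro x ⟨hx, hx'⟩
  refine ⟨(pi_norm_le_iff_of_nonneg zero_le_one).2 hx', ?_⟩
  calc (1 : ℝ) = ∑ i, (ε : Fin (m + 1) → ℝ) i * x i := hx.symm
    _ ≤ ∑ _i : Fin (m + 1), ‖x‖ := by
      refine Finset.sum_le_sum fun i _ => (le_abs_self _).trans ?_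
      rw [abs_mul, ε.2 i, one_mul]
      exact norm_le_pi_norm x i
    _ = (m + 1) * ‖x‖ := by simp

/-- Lists of `k` points on a common facet whose coordinates from `k` on vanish. -/
def crossLists (m k : ℕ) : Set (List (Fin (m + 1) → ℝ)) :=
  {l | l.length = k ∧ ∃ ε : Signs m, ∀ x ∈ l, x ∈ facet (ε : Fin (m + 1) → ℝ) ∧
    ∀ i : Fin (m + 1), k ≤ (i : ℕ) → x i = 0}

lemma anti_mem_supported {k : ℕ} {c : Chain (Fin (m + 1) → ℝ)}
    (hc : c ∈ Finsupp.supported (ZMod 2) (ZMod 2) (crossLists m k)) :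
    anti c ∈ Finsupp.supported (ZMod 2) (ZMod 2) (crossLists m k) := by
  refine map_mem_of_mem_supported _ (fun l hl => ?_) hc
  obtain ⟨h1, ε, h2⟩ := hl
  rw [anti_single]
  refine Finsupp.single_mem_supported _ _ ⟨by simp [h1], ⟨-ε.1, by simpa using ε.2⟩, ?_⟩
  intro x hx
  obtain ⟨y, hy, rfl⟩ := List.mem_map.1 hx
  obtain ⟨⟨h3, h4⟩, h5⟩ := h2 y hy
  exact ⟨⟨by simpa using h3, by simpa using h4⟩, by simpa using h5⟩

lemma cone_mem_supported {k : ℕ} (hk : k < m + 1) {c : Chain (Fin (m + 1) → ℝ)}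
    (hc : c ∈ Finsupp.supported (ZMod 2) (ZMod 2) (crossLists m k)) :
    cone (vertex m k) c ∈ Finsupp.supported (ZMod 2) (ZMod 2) (crossLists m (k + 1)) := by
  refine map_mem_of_mem_supported _ (fun l hl => ?_) hc
  obtain ⟨h1, ε, h2⟩ := hl
  rw [cone_single]
  refine Finsupp.single_mem_supported _ _ ⟨by simp [h1],
    ⟨fun i => if (i : ℕ) = k then 1 else ε.1 i, fun i => ?_⟩, fun x hx => ?_⟩
  · dsimp only
    split_ifs
    exacts [abs_one, ε.2 i]
  rcases List.mem_cons.1 hx with rfl | hx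
  · refine ⟨⟨?_, fun i => ?_⟩, fun i hi => ?_⟩
    · have : ∀ i : Fin (m + 1), (if (i : ℕ) = k then (1 : ℝ) else ε.1 i) * vertex m k i =
          if i = ⟨k, hk⟩ then 1 else 0 := by
        intro i
        simp only [vertex, Fin.ext_iff]
        split_ifs <;> simp
      simp [this]
    · unfold vertex
      split_ifs <;> simp
    · exact if_neg (by omega)
  · obtain ⟨⟨h3, h4⟩, h5⟩ := h2 x hx
    refine ⟨⟨?_, h4⟩, fun i hi => h5 i (by omega)⟩
    refine (Finset.sum_congr rfl fun i _ => ?_).trans h3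
    dsimp only
    split_ifs with hik
    · rw [h5 i hik.ge, mul_zero, mul_zero]
    · rfl

lemma cross_mem_supported {k : ℕ} (hk : k ≤ m + 1) :
    cross (vertex m) k ∈ Finsupp.supported (ZMod 2) (ZMod 2) (crossLists m k) := by
  induction k with
  | zero => exact Finsupp.single_mem_supported _ _ ⟨rfl, ⟨fun _ => 1, by simp⟩, by simp⟩
  | succ k ih =>
    have := cone_mem_supported hk (ih (by omega))
    exact add_mem this (anti_mem_supported this)

end Cube

lemma altCount_cross {V : Type*} [InvolutiveNeg V] (β : List V → V)
    (hβ : ∀ l : List V, β (l.map Neg.neg) = -β l) (e : ℕ → V) (code : V → ℕ) (r k : ℕ)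
    (hk : ∀ j < k, (sd β (j + 1))^[r] (cone (e j) (cross e j)) ∈ Finsupp.supported (ZMod 2) (ZMod 2)
      {l | ∀ x ∈ l, code (-x) = flipLabel (code x) ∧ ∀ y ∈ l, code y ≠ flipLabel (code x)}) :
    altCount code true ((sd β k)^[r] (cross e k)) = 1 := by
  induction k with
  | zero =>
    have : ∀ c : Chain V, (sd β 0)^[r] c = c := fun c => by
      change (id)^[r] c = c
      simp
    rw [this, cross, altCount_single]
    simp [altCode, alt]
  | succ k ih =>
    have h1 := hk k (by omega)
    have hlin : ∀ c c' : Chain V, (sd β (k + 1))^[r] (c + c') =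
        (sd β (k + 1))^[r] c + (sd β (k + 1))^[r] c' := by
      intro c c'
      exact iterate_map_add (sd β (k + 1)) r c c'
    rw [cross, hlin, ← anti_sd_iterate β hβ, map_add, ← altCount_bd, bd_sd_iterate, bd_cone,
      bd_cross, map_zero, add_zero]
    · exact ih fun j hj => hk j (by omega)
    · exact Finsupp.supported_mono (fun l hl x hx => (hl x hx).2) h1
    · exact fun l hl x hx => (((Finsupp.mem_supported _ _).1 h1 hl) x hx).1

/-- Tucker's lemma for an iterated barycentric subdivision of the cross-polytope. -/
lemma exists_complementary {m : ℕ} (r : ℕ) (code : (Fin (m + 1) → ℝ) → ℕ)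
    (hcode : ∀ ε : Signs m, ∀ x ∈ facet (ε : Fin (m + 1) → ℝ), code x / 2 < m ∧
      code (-x) = flipLabel (code x)) :
    ∃ ε : Signs m, ∃ x ∈ facet (ε : Fin (m + 1) → ℝ), ∃ y ∈ facet (ε : Fin (m + 1) → ℝ),
      dist x y ≤ (m / (m + 1)) ^ r * 2 ∧ code y = flipLabel (code x) := by
  by_contra! hcon
  have hsupp : ∀ k ≤ m + 1, ∀ c ∈ Finsupp.supported (ZMod 2) (ZMod 2) (crossLists m k),
      (sd bary k)^[r] c ∈ Finsupp.supported (ZMod 2) (ZMod 2) (⋃ ε : Signs m,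
        smallLists k (facet (ε : Fin (m + 1) → ℝ)) ((m / (m + 1)) ^ r * 2)) := by
    intro k hk c hc
    refine sd_iterate_mem_supported hk _ (fun ε => convex_facet _) zero_le_two r ?_
    refine Finsupp.supported_mono ?_ hc
    rintro l ⟨h1, ε, h2⟩
    refine Set.mem_iUnion.2 ⟨ε, h1, fun x hx => (h2 x hx).1, fun x hx y hy => ?_⟩
    refine (dist_le_norm_add_norm _ _).trans ?_
    linarith [(facet_subset ε (h2 x hx).1).1, (facet_subset ε (h2 y hy).1).1]
  have hne : ∀ k, ∀ l ∈ ⋃ ε : Signs m, smallLists k (facet (ε : Fin (m + 1) → ℝ))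
      ((m / (m + 1)) ^ r * 2), ∀ x ∈ l, code x / 2 < m ∧ code (-x) = flipLabel (code x) ∧
      ∀ y ∈ l, code y ≠ flipLabel (code x) := by
    intro k l hl x hx
    obtain ⟨ε, -, h1, h2⟩ := Set.mem_iUnion.1 hl
    have := hcode ε x (h1 x hx)
    exact ⟨this.1, this.2, fun y hy => hcon ε x (h1 x hx) y (h1 y hy) (h2 x hx y hy)⟩
  have hcount := altCount_cross bary bary_map_neg (vertex m) code r (m + 1) fun j hj =>
    Finsupp.supported_mono (fun l hl x hx => (hne _ l hl x hx).2)
      (hsupp (j + 1) hj _ (cone_mem_supported hj (cross_mem_supported hj.le)))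
  obtain ⟨l, hl, halt⟩ : ∃ l ∈ ⋃ ε : Signs m, smallLists (m + 1) (facet (ε : Fin (m + 1) → ℝ))
      ((m / (m + 1)) ^ r * 2), altCode true (l.map code) ≠ 0 := by
    by_contra! h0
    have := map_mem_of_mem_supported (altCount code true) (P := ⊥)
      (fun l hl => by simpa using h0 l hl) (hsupp (m + 1) le_rfl _ (cross_mem_supported le_rfl))
    rw [hcount] at this
    simp at this
  have hlen : l.length = m + 1 := by
    obtain ⟨ε, h1, -⟩ := Set.mem_iUnion.1 hl
    exact h1
  have hperm := List.mergeSort_perm (l.map code) (· ≤ ·)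
  have := length_le_of_alt (m := m) true _ (pairwise_sort (l.map code)) (fun x hx y hy => ?_) halt 0
    (fun x hx => ?_) (by omega)
  · have := hperm.length_eq
    simp only [List.length_map] at this
    omega
  · obtain ⟨u, hu, rfl⟩ := List.mem_map.1 (hperm.mem_iff.1 hx)
    obtain ⟨v, hv, rfl⟩ := List.mem_map.1 (hperm.mem_iff.1 hy)
    exact (hne _ l hl u hu).2.2 v hv
  · obtain ⟨u, hu, rfl⟩ := List.mem_map.1 (hperm.mem_iff.1 hx)
    exact ⟨Nat.zero_le _, (hne _ l hl u hu).1⟩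

theorem exists_zero_aux {m : ℕ} (f : (Fin (m + 1) → ℝ) → Fin m → ℝ) (hf : Continuous f)
    (hodd : ∀ x, f (-x) = -f x) : ∃ x, x ≠ 0 ∧ f x = 0 := by
  by_contra! hcon
  set C : Set (Fin (m + 1) → ℝ) := {x | ‖x‖ ≤ 1 ∧ 1 ≤ (m + 1) * ‖x‖} with hC
  have hcomp : IsCompact C := by
    have : C = Metric.closedBall 0 1 ∩ {x | 1 ≤ (m + 1) * ‖x‖} := by
      ext x; simp [hC]
    rw [this]
    exact (isCompact_closedBall _ _).inter_right
      (isClosed_le continuous_const (continuous_const.mul continuous_norm))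
  have hCne : C.Nonempty := ⟨fun _ => 1, by simp [hC, pi_norm_const]⟩
  obtain ⟨x₀, hx₀, hmin⟩ := hcomp.exists_isMinOn hCne (f := fun x => ‖f x‖) (by fun_prop)
  have h0 : ∀ x ∈ C, x ≠ 0 := by
    rintro x ⟨-, hx⟩ rfl
    simp at hx
    linarith
  set δ := ‖f x₀‖
  have hδ : 0 < δ := norm_pos_iff.2 (hcon _ (h0 _ hx₀))
  have hex : ∀ x ∈ C, ∃ j, δ ≤ |f x j| := by
    intro x hx
    by_contra! h
    exact absurd (hmin hx) (not_le.2 ((pi_norm_lt_iff hδ).2 h))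
  have : Nonempty (Fin m) := ⟨(hex _ hx₀).choose⟩
  have hJ : ∀ w : Fin m → ℝ, ∃ j, (∃ i, δ ≤ w i) → δ ≤ w j := by
    intro w
    by_cases h : ∃ i, δ ≤ w i
    · obtain ⟨i, hi⟩ := h
      exact ⟨i, fun _ => hi⟩
    · exact ⟨Classical.arbitrary _, fun h' => absurd h' h⟩
  choose J hJ using hJ
  set jj : (Fin (m + 1) → ℝ) → Fin m := fun x => J fun i => |f x i|
  have hjj : ∀ x ∈ C, δ ≤ |f x (jj x)| := fun x hx => hJ (fun i => |f x i|) (hex x hx)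
  have hjjneg : ∀ x, jj (-x) = jj x := fun x => by simp [jj, hodd]
  set code : (Fin (m + 1) → ℝ) → ℕ := fun x => 2 * jj x + if 0 < f x (jj x) then 1 else 0
  have hpos : ∀ x, 0 < f x (jj x) → code x = 2 * jj x + 1 := fun x hx => by simp [code, hx]
  have hneg : ∀ x, f x (jj x) < 0 → code x = 2 * jj x := fun x hx => by simp [code, hx.le]
  obtain ⟨η, hη, hunif⟩ := Metric.uniformContinuousOn_iff.1
    (hcomp.uniformContinuousOn_of_continuous hf.continuousOn) δ hδ
  obtain ⟨r, hr⟩ : ∃ r : ℕ, ((m : ℝ) / (m + 1)) ^ r < η / 2 :=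
    exists_pow_lt_of_lt_one (by positivity) 
      (by rw [div_lt_one] <;> linarith [Nat.cast_nonneg (α := ℝ) m])
  obtain ⟨ε, x, hx, y, hy, hxy, hcode⟩ := exists_complementary r code fun ε x hx => by
    have hxC := hjj x (facet_subset ε hx)
    have hlt := (jj x).isLt
    have hjx := hjjneg x
    rcases le_abs.1 hxC with h | h
    · have h1 := hpos x (by linarith)
      have h2 := hneg (-x) (by rw [hjx, hodd, Pi.neg_apply]; linarith)
      rw [hjx] at h2
      unfold flipLabel
      split_ifs <;> omega
    · have h1 := hneg x (by linarith)
      have h2 := hpos (-x) (by rw [hjx, hodd, Pi.neg_apply]; linarith)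
      rw [hjx] at h2
      unfold flipLabel
      split_ifs <;> omega
  have hx' := facet_subset ε hx
  have hy' := facet_subset ε hy
  have hd := hunif x hx' y hy' (by linarith)
  have h1 := hjj x hx'
  have h2 := hjj y hy'
  have hJxy : jj y = jj x := by
    simp only [code, flipLabel] at hcode
    ext
    split_ifs at hcode <;> omega
  have hd2 := (dist_le_pi_dist (f x) (f y) (jj x)).trans_lt hd
  rw [Real.dist_eq, abs_lt] at hd2
  rw [flipLabel] at hcode
  rcases le_abs.1 h1 with h1 | h1 <;> rcases le_abs.1 h2 with h2 | h2
  · have h3 := hpos x (by linarith)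
    have h4 := hpos y (by linarith)
    rw [hJxy] at h4
    split_ifs at hcode <;> omega
  · rw [hJxy] at h2
    linarith
  · rw [hJxy] at h2
    linarith
  · have h3 := hneg x (by linarith)
    have h4 := hneg y (by linarith)
    rw [hJxy] at h4
    split_ifs at hcode <;> omega

/-- The **Borsuk–Ulam theorem**: a continuous odd map to a space of smaller dimension has a nonzero
zero. -/
theorem exists_zero {V W : Type*} [NormedAddCommGroup V] [NormedSpace ℝ V] [FiniteDimensional ℝ V]
    [NormedAddCommGroup W] [NormedSpace ℝ W] [FiniteDimensional ℝ W]
    (hdim : Module.finrank ℝ W < Module.finrank ℝ V) (f : V → W) (hf : Continuous f)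
    (hodd : ∀ x, f (-x) = -f x) : ∃ x, x ≠ 0 ∧ f x = 0 := by
  obtain ⟨m, hm⟩ : ∃ m, Module.finrank ℝ V = m + 1 := ⟨_, (Nat.succ_pred_eq_of_pos (by omega)).symm⟩
  let eV : V ≃L[ℝ] (Fin (m + 1) → ℝ) := ContinuousLinearEquiv.ofFinrankEq (by simp [hm])
  let eW : W ≃L[ℝ] (Fin (Module.finrank ℝ W) → ℝ) := ContinuousLinearEquiv.ofFinrankEq (by simp)
  have hle : Module.finrank ℝ W ≤ m := by omega
  let j : W →ₗ[ℝ] (Fin m → ℝ) :=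
    Function.ExtendByZero.linearMap ℝ (Fin.castLE hle) ∘ₗ eW.toLinearMap
  have hj : ∀ w, j w = 0 → w = 0 := by
    intro w hw
    have : eW w = 0 := by
      ext i
      have := congr_fun hw (Fin.castLE hle i)
      simpa [j, (Fin.castLE_injective hle).extend_apply] using this
    simpa using this
  obtain ⟨x, hx, hfx⟩ := exists_zero_aux (fun x => j (f (eV.symm x)))
    ((LinearMap.continuous_of_finiteDimensional j).comp (hf.comp eV.symm.continuous))
    (fun x => by simp [hodd])
  exact ⟨eV.symm x, by simpa using hx, hj _ hfx⟩

end

end BorsukUlam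

namespace ChordDiagram

noncomputable section

/-- Clamping to the unit interval. -/
def clamp (t : ℝ) : ℝ := max 0 (min t 1)

lemma clamp_of_mem {t : ℝ} (h0 : 0 ≤ t) (h1 : t ≤ 1) : clamp t = t := by
  rw [clamp, min_eq_left h1, max_eq_right h0]

/-- The homogeneous extension `(L, τ) ↦ L • γ (τ / L)` of a path `γ` on the unit interval. -/
def homog {M : Type*} [AddCommGroup M] [Module ℝ M] (γ : ℝ → M) (L τ : ℝ) : M :=
  L • γ (clamp (τ / L))

lemma map_homog {M M' : Type*} [AddCommGroup M] [Module ℝ M] [AddCommGroup M'] [Module ℝ M']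
    (θ : M →ₗ[ℝ] M') (γ : ℝ → M) (L τ : ℝ) : θ (homog γ L τ) = homog (θ ∘ γ) L τ := by
  simp [homog]

lemma continuous_homog {W : Type*} [NormedAddCommGroup W] [NormedSpace ℝ W] {γ : ℝ → W}
    (hγ : Continuous γ) : Continuous fun p : ℝ × ℝ => homog γ p.1 p.2 := by
  have hc : Continuous clamp := by unfold clamp; fun_prop
  rw [continuous_iff_continuousAt]
  rintro ⟨L, τ⟩
  by_cases hL : L = 0
  · subst hL
    obtain ⟨B, hB⟩ := isCompact_Icc.exists_bound_of_continuousOn (s := Set.Icc (0 : ℝ) 1)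
      hγ.continuousOn
    have h0 : homog γ 0 τ = 0 := by simp [homog]
    rw [ContinuousAt, h0]
    refine squeeze_zero_norm (a := fun p : ℝ × ℝ => |p.1| * B) (fun p => ?_) ?_
    · rw [homog, norm_smul, Real.norm_eq_abs]
      refine mul_le_mul_of_nonneg_left (hB _ ⟨?_, ?_⟩) (abs_nonneg _) <;> simp [clamp]
    · have : Continuous fun p : ℝ × ℝ => |p.1| * B := by fun_prop
      simpa using this.tendsto ((0 : ℝ), τ)
  · unfold homog
    have h1 : ContinuousAt (fun p : ℝ × ℝ => p.2 / p.1) (L, τ) :=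
      continuousAt_snd.div continuousAt_fst hL
    exact continuousAt_fst.smul
      ((hγ.comp hc).continuousAt.comp (f := fun p : ℝ × ℝ => p.2 / p.1) h1)

/-- The alternating sum of the increments of `G` over consecutive intervals of lengths `|x i|`
starting at `a`, the increment over the `i`-th interval being weighted by the sign of `x i`. -/
def signedSum {M : Type*} [AddCommGroup M] (G : ℝ → M) : (m : ℕ) → ℝ → (Fin m → ℝ) → M
  | 0, _, _ => 0
  | m + 1, a, x => G (a + max (x 0) 0) - G (a + max (-x 0) 0) +
      signedSum G m (a + |x 0|) (Fin.tail x)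

lemma signedSum_neg {M : Type*} [AddCommGroup M] (G : ℝ → M) (m : ℕ) (a : ℝ) (x : Fin m → ℝ) :
    signedSum G m a (-x) = -signedSum G m a x := by
  induction m generalizing a with
  | zero => simp [signedSum]
  | succ m ih =>
    have : Fin.tail (-x) = -Fin.tail x := rfl
    simp only [signedSum, this, ih, Pi.neg_apply, neg_neg, abs_neg]
    abel

@[simp] lemma signedSum_zero {M : Type*} [AddCommGroup M] (G : ℝ → M) (m : ℕ) (a : ℝ) :
    signedSum G m a 0 = 0 := by
  induction m generalizing a with
  | zero => simp [signedSum]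
  | succ m ih =>
    have : Fin.tail (0 : Fin (m + 1) → ℝ) = 0 := rfl
    simp [signedSum, this, ih]

section signedSum

variable {M : Type*} [AddCommGroup M] [Module ℝ M]

lemma map_signedSum {M' : Type*} [AddCommGroup M'] [Module ℝ M']
    (θ : M →ₗ[ℝ] M') (G : ℝ → M) (m : ℕ) (a : ℝ) (x : Fin m → ℝ) :
    θ (signedSum G m a x) = signedSum (θ ∘ G) m a x := by
  induction m generalizing a with
  | zero => simp [signedSum]
  | succ m ih => simp [signedSum, ih]

lemma continuous_signedSum {X W : Type*} [TopologicalSpace X] [AddCommGroup W]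
    [TopologicalSpace W] [IsTopologicalAddGroup W] (G : X → ℝ → W)
    (hG : Continuous fun p : X × ℝ => G p.1 p.2) (m : ℕ) (a : X → ℝ) (ha : Continuous a)
    (x : X → Fin m → ℝ) (hx : Continuous x) :
    Continuous fun u => signedSum (G u) m (a u) (x u) := by
  have hG' : ∀ b : X → ℝ, Continuous b → Continuous fun u => G u (b u) :=
    fun b hb => hG.comp (continuous_id.prodMk hb)
  induction m generalizing a with
  | zero => exact continuous_const
  | succ m ih =>
    have h0 : Continuous fun u => x u 0 := by fun_prop
    refine ((hG' _ (by fun_prop)).sub (hG' _ (by fun_prop))).add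
      (ih _ (by fun_prop) _ ?_)
    unfold Fin.tail
    fun_prop

/-- `2 G q₀ - 2 G q₁ + ⋯ ± G b`. -/
def altSum (G : ℝ → M) (b : ℝ) : List ℝ → M
  | [] => G b
  | q :: qs => (2 : ℝ) • G q - altSum G b qs

lemma signedSum_eq (G : ℝ → M) (m : ℕ) (a : ℝ) (x : Fin m → ℝ) (hx : x ≠ 0) :
    ∃ ε : ℝ, (ε = 1 ∨ ε = -1) ∧ ∃ qs : List ℝ, qs.Pairwise (· < ·) ∧ qs.length + 1 ≤ m ∧
      (∀ q ∈ qs, a < q ∧ q < a + ∑ i, |x i|) ∧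
      signedSum G m a x = ε • (altSum G (a + ∑ i, |x i|) qs - G a) := by
  induction m generalizing a with
  | zero => exact absurd (Subsingleton.elim _ _) hx
  | succ m ih =>
    have hsum : a + ∑ i, |x i| = a + |x 0| + ∑ i, |Fin.tail x i| := by
      rw [Fin.sum_univ_succ, add_assoc]; rfl
    rw [signedSum, hsum]
    by_cases ht : Fin.tail x = 0
    · have h0 : x 0 ≠ 0 := fun h0 => hx <| by
        ext i
        refine Fin.cases h0 (fun i => congr_fun ht i) i
      rw [ht]
      rcases lt_or_gt_of_ne h0 with h | h
      · refine ⟨-1, Or.inr rfl, [], List.Pairwise.nil, by simp, by simp, ?_⟩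
        simp [altSum, max_eq_right h.le, max_eq_left (neg_pos.2 h).le, abs_of_neg h]
      · refine ⟨1, Or.inl rfl, [], List.Pairwise.nil, by simp, by simp, ?_⟩
        simp [altSum, max_eq_right (neg_neg_of_pos h).le, max_eq_left h.le, abs_of_pos h]
    · obtain ⟨ε, hε, qs, h1, h2, h3, h4⟩ := ih (a + |x 0|) _ ht
      by_cases h0 : x 0 = 0
      · simp only [h0, abs_zero, add_zero] at h3 h4 ⊢
        exact ⟨ε, hε, qs, h1, by omega, h3, by simp [h4]⟩
      have hpos : 0 < |x 0| := abs_pos.2 h0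
      obtain ⟨ε₀, hε₀, hfirst⟩ : ∃ ε₀ : ℝ, (ε₀ = 1 ∨ ε₀ = -1) ∧
          G (a + max (x 0) 0) - G (a + max (-x 0) 0) = ε₀ • (G (a + |x 0|) - G a) := by
        rcases lt_or_gt_of_ne h0 with h | h
        · exact ⟨-1, Or.inr rfl, by
            simp [max_eq_right h.le, max_eq_left (neg_pos.2 h).le, abs_of_neg h]⟩
        · exact ⟨1, Or.inl rfl, by
            simp [max_eq_right (neg_neg_of_pos h).le, max_eq_left h.le, abs_of_pos h]⟩
      by_cases hεε : ε = ε₀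
      · refine ⟨ε₀, hε₀, qs, h1, by omega, fun q hq => ⟨by linarith [(h3 q hq).1], (h3 q hq).2⟩, ?_⟩
        rw [h4, hfirst, hεε]
        module
      · refine ⟨ε₀, hε₀, (a + |x 0|) :: qs, ?_, ?_, ?_, ?_⟩
        · exact List.pairwise_cons.2 ⟨fun q hq => (h3 q hq).1, h1⟩
        · simp only [List.length_cons]; omega
        · intro q hq
          rcases List.mem_cons.1 hq with rfl | hq
          · refine ⟨by linarith, lt_add_of_pos_right _ ?_⟩
            obtain ⟨i, hi⟩ := Function.ne_iff.1 ht
            exact Finset.sum_pos' (fun i _ => abs_nonneg _) ⟨i, Finset.mem_univ _, abs_pos.2 hi⟩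
          · exact ⟨by linarith [(h3 q hq).1], (h3 q hq).2⟩
        · have : ε = -ε₀ := by
            rcases hε with rfl | rfl <;> rcases hε₀ with rfl | rfl <;> simp at hεε ⊢
          rw [h4, hfirst, altSum, this]
          module

lemma altSum_eq_sum (G : ℝ → M) (b : ℝ) (k : ℕ) (qs : List ℝ) (hqs : qs.length = 2 * k) :
    altSum G b qs = G b + (2 : ℝ) • ∑ j ∈ Finset.range k,
      (G (qs.getD (2 * j) 0) - G (qs.getD (2 * j + 1) 0)) := by
  induction k generalizing qs with
  | zero =>
    obtain rfl := List.length_eq_zero_iff.1 hqs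
    simp [altSum]
  | succ k ih =>
    match qs, hqs with
    | q :: q' :: qs, hqs =>
      have := ih qs (by simp at hqs; omega)
      rw [altSum, altSum, this, Finset.sum_range_succ']
      have h2 : ∀ j, 2 * (j + 1) = 2 * j + 1 + 1 := fun j => by ring
      simp only [h2, List.getD_cons_succ, mul_zero, List.getD_cons_zero, zero_add]
      module

end signedSum

/-- An odd family of alternating sums along the path `γ` on the unit interval. -/
def circle {M : Type*} [AddCommGroup M] [Module ℝ M] (γ : ℝ → M) {m : ℕ} (x : Fin m → ℝ) : M :=
  signedSum (homog γ (∑ i, |x i|)) m 0 x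

lemma map_circle {M M' : Type*} [AddCommGroup M] [Module ℝ M] [AddCommGroup M'] [Module ℝ M']
    (θ : M →ₗ[ℝ] M') (γ : ℝ → M) {m : ℕ} (x : Fin m → ℝ) :
    θ (circle γ x) = circle (θ ∘ γ) x := by
  rw [circle, map_signedSum, circle]
  congr 1
  ext τ
  exact map_homog θ γ _ τ

lemma circle_neg {M : Type*} [AddCommGroup M] [Module ℝ M] (γ : ℝ → M) {m : ℕ} (x : Fin m → ℝ) :
    circle γ (-x) = -circle γ x := by
  simp [circle, signedSum_neg]

@[simp] lemma circle_zero {M : Type*} [AddCommGroup M] [Module ℝ M] (γ : ℝ → M) {m : ℕ} :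
    circle γ (0 : Fin m → ℝ) = 0 := by
  simp [circle]

lemma continuous_circle {W : Type*} [NormedAddCommGroup W] [NormedSpace ℝ W] {γ : ℝ → W}
    (hγ : Continuous γ) (m : ℕ) : Continuous fun x : Fin m → ℝ => circle γ x := by
  refine continuous_signedSum (fun x : Fin m → ℝ => homog γ (∑ i, |x i|)) ?_ m _
    continuous_const _ continuous_id
  exact (continuous_homog hγ).comp (f := fun p : (Fin m → ℝ) × ℝ => (∑ i, |p.1 i|, p.2))
    (by fun_prop)

/-- A closed alternating sum along `γ` with cuts at `p 0, …, p (2 k - 1)`. -/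
def cutSum {M : Type*} [AddCommGroup M] [Module ℝ M] (γ : ℝ → M) (k : ℕ) (p : ℕ → ℝ) : M :=
  γ 1 - γ 0 + (2 : ℝ) • ∑ j ∈ Finset.range k, (γ (p (2 * j)) - γ (p (2 * j + 1)))

/-- The first `m` values of `p` are increasing points of `[0, 1)`. -/
structure IsCuts (m : ℕ) (p : ℕ → ℝ) : Prop where
  lt : ∀ i j, i < j → j < m → p i < p j
  nonneg : ∀ i < m, 0 ≤ p i
  lt_one : ∀ i < m, p i < 1

section IsCuts

variable {p : ℕ → ℝ}

lemma IsCuts.le {m : ℕ} (hp : IsCuts m p) {i j : ℕ} (hij : i ≤ j) (hj : j < m) : p i ≤ p j := by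
  rcases hij.eq_or_lt with rfl | h
  · exact le_rfl
  · exact (hp.lt i j h hj).le

lemma IsCuts.injOn {m : ℕ} (hp : IsCuts m p) {i j : ℕ} (hi : i < m) (hj : j < m)
    (h : p i = p j) : i = j := by
  rcases lt_trichotomy i j with hij | hij | hij
  · exact absurd h (hp.lt i j hij hj).ne
  · exact hij
  · exact absurd h (hp.lt j i hij hi).ne'

lemma IsCuts.of_le {m m' : ℕ} (hp : IsCuts m p) (h : m' ≤ m) : IsCuts m' p :=
  ⟨fun i j hij hj => hp.lt i j hij (hj.trans_le h), fun i hi => hp.nonneg i (hi.trans_le h),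
    fun i hi => hp.lt_one i (hi.trans_le h)⟩

end IsCuts

lemma circle_eq_cutSum {M : Type*} [AddCommGroup M] [Module ℝ M] (γ : ℝ → M) {r : ℕ}
    {x : Fin (2 * r + 1) → ℝ} (hx : x ≠ 0) :
    ∃ k ≤ r, ∃ p : ℕ → ℝ, IsCuts (2 * k) p ∧ ∃ c : ℝ, c ≠ 0 ∧ circle γ x = c • cutSum γ k p := by
  set L := ∑ i, |x i| with hL
  have hLpos : 0 < L := by
    obtain ⟨i, hi⟩ := Function.ne_iff.1 hx
    exact Finset.sum_pos' (fun i _ => abs_nonneg _) ⟨i, Finset.mem_univ _, abs_pos.2 hi⟩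
  obtain ⟨ε, hε, qs, h1, h2, h3, h4⟩ : ∃ ε : ℝ, ε ≠ 0 ∧ ∃ qs : List ℝ, qs.Pairwise (· < ·) ∧
      (∃ k ≤ r, qs.length = 2 * k) ∧ (∀ q ∈ qs, 0 ≤ q ∧ q < L) ∧
      circle γ x = ε • (altSum (homog γ L) L qs - homog γ L 0) := by
    obtain ⟨ε, hε, qs, h1, h2, h3, h4⟩ := signedSum_eq (homog γ L) _ 0 x hx
    rw [zero_add, ← hL] at h3 h4
    have hε0 : ε ≠ 0 := by rcases hε with rfl | rfl <;> simp
    rcases Nat.even_or_odd' qs.length with ⟨k, hk | hk⟩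
    · exact ⟨ε, hε0, qs, h1, ⟨k, by omega, hk⟩, fun q hq => ⟨(h3 q hq).1.le, (h3 q hq).2⟩, h4⟩
    · refine ⟨-ε, neg_ne_zero.2 hε0, 0 :: qs, List.pairwise_cons.2 ⟨fun q hq => (h3 q hq).1, h1⟩,
        ⟨k + 1, by omega, by simp [hk]; ring⟩, fun q hq => ?_, ?_⟩
      · rcases List.mem_cons.1 hq with rfl | hq
        exacts [⟨le_rfl, hLpos⟩, ⟨(h3 q hq).1.le, (h3 q hq).2⟩]
      · rw [circle, h4, altSum]
        module
  obtain ⟨k, hkr, hk⟩ := h2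
  have hmem : ∀ i < 2 * k, qs.getD i 0 ∈ qs := fun i hi => by
    rw [List.getD_eq_getElem _ _ (by omega)]
    exact List.getElem_mem _
  have hc : ∀ i < 2 * k, homog γ L (qs.getD i 0) = L • γ (qs.getD i 0 / L) := fun i hi => by
    have := h3 _ (hmem i hi)
    rw [homog, clamp_of_mem (by have := this.1; positivity)
      (by rw [div_le_one hLpos]; exact this.2.le)]
  refine ⟨k, hkr, fun i => qs.getD i 0 / L, ⟨fun i j hij hj => ?_, fun i hi => ?_, fun i hi => ?_⟩,
    ε * L, mul_ne_zero hε hLpos.ne', ?_⟩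
  · refine div_lt_div_of_pos_right ?_ hLpos
    rw [List.getD_eq_getElem _ _ (by omega), List.getD_eq_getElem _ _ (by omega)]
    exact List.pairwise_iff_getElem.1 h1 _ _ _ _ hij
  · exact div_nonneg (h3 _ (hmem i hi)).1 hLpos.le
  · rw [div_lt_one hLpos]
    exact (h3 _ (hmem i hi)).2
  · rw [h4, altSum_eq_sum _ _ k qs hk, cutSum]
    have hsum : ∑ j ∈ Finset.range k, (homog γ L (qs.getD (2 * j) 0) -
        homog γ L (qs.getD (2 * j + 1) 0)) = L • ∑ j ∈ Finset.range k,
          (γ (qs.getD (2 * j) 0 / L) - γ (qs.getD (2 * j + 1) 0 / L)) := by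
      rw [Finset.smul_sum]
      refine Finset.sum_congr rfl fun j hj => ?_
      rw [Finset.mem_range] at hj
      rw [hc _ (by omega), hc _ (by omega), smul_sub]
    have hb : homog γ L L = L • γ 1 := by
      rw [homog, div_self hLpos.ne', clamp_of_mem zero_le_one le_rfl]
    have ha : homog γ L 0 = L • γ 0 := by
      rw [homog, zero_div, clamp_of_mem le_rfl zero_le_one]
    rw [hsum, ha, hb]
    module

end

noncomputable section

/-- The point mass at `t`, as a formal combination of points. -/
def pt (t : ℝ) : ℝ →₀ ℝ := Finsupp.single t 1

/-- Evaluation of continuous functions on formal combinations of points. -/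
def evalAt : (ℝ →₀ ℝ) →ₗ[ℝ] C(ℝ, ℝ) →ₗ[ℝ] ℝ :=
  Finsupp.linearCombination ℝ fun t =>
    { toFun := fun f => f t
      map_add' := fun _ _ => rfl
      map_smul' := fun _ _ => rfl }

@[simp] lemma evalAt_pt (t : ℝ) (f : C(ℝ, ℝ)) : evalAt (pt t) f = f t := by
  simp [evalAt, pt]

lemma evalAt_chord (a b : ℝ) : evalAt (pt b - pt a) = evalDiff a b := by
  ext f
  simp [evalDiff]

lemma evalAt_injective : Function.Injective evalAt := by
  rw [injective_iff_map_eq_zero]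
  intro c hc
  ext t
  by_contra ht
  let f : C(ℝ, ℝ) := ⟨fun x => ∏ s ∈ c.support.erase t, (x - s), by fun_prop⟩
  have h1 : evalAt c f = c t * f t := by
    rw [evalAt, Finsupp.linearCombination_apply, Finsupp.sum, LinearMap.sum_apply]
    refine Finset.sum_eq_single t (fun s hs hst => ?_) (fun h => ?_)
    · have : f s = 0 := Finset.prod_eq_zero (Finset.mem_erase.2 ⟨hst, hs⟩) (sub_self s)
      simp [this]
    · simp [Finsupp.notMem_support_iff.1 h]
  have h2 : f t ≠ 0 := Finset.prod_ne_zero_iff.2 fun s hs =>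
    sub_ne_zero.2 (Finset.ne_of_mem_erase hs).symm
  rw [hc] at h1
  exact mul_ne_zero ht h2 h1.symm

/-- The set of formal differences of endpoints of chords. -/
def chords : Set (ℝ →₀ ℝ) := {v | ∃ a b, a < b ∧ v = pt b - pt a}

lemma infinite_of_chords_subset_span {E : Set (ℝ →₀ ℝ)}
    (hE : chords ⊆ (Submodule.span ℝ E : Set (ℝ →₀ ℝ))) : E.Infinite := by
  intro hfin
  have hU : (⋃ v ∈ E, (v.support : Set ℝ)).Finite :=
    hfin.biUnion fun v _ => v.support.finite_toSet
  have hle : Submodule.span ℝ E ≤ Finsupp.supported ℝ ℝ (⋃ v ∈ E, (v.support : Set ℝ)) :=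
    Submodule.span_le.2 fun v hv => Set.subset_biUnion_of_mem (u := fun v => (v.support : Set ℝ)) hv
  refine Set.infinite_univ (hU.subset fun s _ => ?_)
  refine (Finsupp.mem_supported _ _).1 (hle (hE ⟨s, s + 1, by linarith, rfl⟩)) ?_
  simp [pt]

lemma exists_linearIndependent_chords {T : Set (ℝ →₀ ℝ)} (hT : T ⊆ chords) {n : ℕ}
    (hn : n ≠ 0) (hfin : T.Finite) (hcard : T.ncard ≤ n) :
    ∃ a b : Fin n → ℝ, (∀ i, a i < b i) ∧ LinearIndependent ℝ (fun i => pt (b i) - pt (a i)) ∧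
      T ⊆ Submodule.span ℝ (Set.range fun i => pt (b i) - pt (a i)) := by
  obtain ⟨B, hBT, hspan, hB⟩ := exists_linearIndependent ℝ T
  have hBC := hBT.trans hT
  replace hB : LinearIndepOn ℝ id B := hB
  obtain ⟨B', h1, h2, h3⟩ := (infinite_of_chords_subset_span (E := hB.extend hBC)
    (by rw [hB.span_extend_eq_span]; exact Submodule.subset_span)).exists_superset_ncard_eq
    (hB.subset_extend hBC) (hfin.subset hBT) ((Set.ncard_le_ncard hBT hfin).trans hcard)
  have hLI : LinearIndependent ℝ ((↑) : B' → ℝ →₀ ℝ) := (hB.linearIndepOn_extend hBC).mono h2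
  obtain ⟨e⟩ : Nonempty (Fin n ≃ B') := by
    have := Nat.finite_of_card_ne_zero (α := B') (by rwa [Nat.card_coe_set_eq, h3])
    exact ⟨(Finite.equivFinOfCardEq (by rw [Nat.card_coe_set_eq, h3])).symm⟩
  choose a b hab hv using fun i => h2.trans (hB.extend_subset hBC) (e i).2
  have hfun : (fun i => pt (b i) - pt (a i)) = fun i => (e i : ℝ →₀ ℝ) :=
    funext fun i => (hv i).symm
  refine ⟨a, b, hab, ?_, ?_⟩
  · rw [hfun]
    exact hLI.comp _ e.injective
  · have hr : Set.range (fun i => (e i : ℝ →₀ ℝ)) = B' := by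
      rw [← Function.comp_def, e.surjective.range_comp, Subtype.range_coe]
    rw [hfun, hr]
    exact (Submodule.subset_span.trans_eq (by rw [hspan])).trans (Submodule.span_mono h1)

lemma finrank_map_add_le {K V W : Type*} [Field K] [AddCommGroup V] [Module K V] [AddCommGroup W]
    [Module K W] (g : V →ₗ[K] W) (X : Submodule K V) [FiniteDimensional K X] {m : ℕ}
    {ν : Fin m → V} (hν : LinearIndependent K ν) (hX : ∀ j, ν j ∈ X) (hg : ∀ j, g (ν j) = 0) :
    Module.finrank K (X.map g) + m ≤ Module.finrank K X := by
  have hrank := (g ∘ₗ X.subtype).finrank_range_add_finrank_ker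
  rw [LinearMap.range_comp, Submodule.range_subtype] at hrank
  let ν' : Fin m → LinearMap.ker (g ∘ₗ X.subtype) := fun j => ⟨⟨ν j, hX j⟩, hg j⟩
  have hLI : LinearIndependent K ν' :=
    LinearIndependent.of_comp (X.subtype ∘ₗ (LinearMap.ker (g ∘ₗ X.subtype)).subtype) hν
  have := hLI.fintype_card_le_finrank
  rw [Fintype.card_fin] at this
  omega

theorem exists_diagram {n N : ℕ} (hn : n ≠ 0) {F : Submodule ℝ C(ℝ, ℝ)} [FiniteDimensional ℝ F]
    (hF : Module.finrank ℝ F = N) {ι : Type*} [Fintype ι] (hι : Fintype.card ι ≤ n) (a b : ι → ℝ)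
    (ν : Fin 2 → ℝ →₀ ℝ) (hν : LinearIndependent ℝ ν)
    (hspan : ∀ j, ν j ∈ Submodule.span ℝ (Set.range fun i => pt (b i) - pt (a i)))
    (heval : ∀ j, ∀ f ∈ F, evalAt (ν j) f = 0) :
    ∃ a b : Fin n → ℝ,
      (∀ i, a i < b i) ∧
      Function.Injective (fun i => (a i, b i)) ∧
      LinearIndependent ℝ (fun i => evalDiff (a i) (b i)) ∧
      (N : ℤ) - n + 2 ≤
        Module.finrank ℝ ↥(F ⊓ ⨅ i, LinearMap.ker (evalDiff (a i) (b i))) := by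
  classical
  set T : Finset (ℝ →₀ ℝ) := (Finset.univ.filter fun i => a i ≠ b i).image
    fun i => pt (max (a i) (b i)) - pt (min (a i) (b i))
  have hT : (T : Set (ℝ →₀ ℝ)) ⊆ chords := by
    intro v hv
    simp only [T, Finset.coe_image, Set.mem_image, Finset.coe_filter, Set.mem_ofPred_eq] at hv
    obtain ⟨i, ⟨-, hi⟩, rfl⟩ := hv
    exact ⟨_, _, min_lt_max.2 hi, rfl⟩
  obtain ⟨a', b', hab, hLI, hTs⟩ := exists_linearIndependent_chords (n := n) hT hn T.finite_toSet
    (by rw [Set.ncard_coe_finset]; exact Finset.card_image_le.trans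
          ((Finset.card_le_univ _).trans hι))
  set X := Submodule.span ℝ (Set.range fun i => pt (b' i) - pt (a' i)) with hX
  have hνX : ∀ j, ν j ∈ X := by
    intro j
    refine Submodule.span_le.2 ?_ (hspan j)
    rintro _ ⟨i, rfl⟩
    have hmem : a i ≠ b i → pt (max (a i) (b i)) - pt (min (a i) (b i)) ∈ X := fun h =>
      hTs (Finset.mem_coe.2 (Finset.mem_image_of_mem _ (by simpa using h)))
    rcases lt_trichotomy (a i) (b i) with h | h | h
    · simpa [max_eq_right h.le, min_eq_left h.le] using hmem h.ne
    · simp [h]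
    · have := hmem h.ne'
      rw [max_eq_left h.le, min_eq_right h.le] at this
      simpa using X.neg_mem this
  refine ⟨a', b', hab, fun i j hij => hLI.injective ?_, ?_, ?_⟩
  · simp only [Prod.mk.injEq] at hij
    simp [hij.1, hij.2]
  · simpa only [Function.comp_def, evalAt_chord] using
      hLI.map' evalAt (LinearMap.ker_eq_bot.2 evalAt_injective)
  · let evF : (ℝ →₀ ℝ) →ₗ[ℝ] Module.Dual ℝ F := F.subtype.dualMap ∘ₗ evalAt
    have : FiniteDimensional ℝ X := FiniteDimensional.span_of_finite ℝ (Set.finite_range _)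
    have hXn : Module.finrank ℝ X = n := by
      rw [hX, finrank_span_eq_card hLI, Fintype.card_fin]
    have hrank := finrank_map_add_le evF X hν hνX fun j => LinearMap.ext fun f => heval j f f.2
    have hco := Subspace.finrank_add_finrank_dualCoannihilator_eq (X.map evF)
    have hle : Submodule.map F.subtype (X.map evF).dualCoannihilator ≤
        F ⊓ ⨅ i, LinearMap.ker (evalDiff (a' i) (b' i)) := by
      rintro _ ⟨f, hf, rfl⟩
      refine ⟨f.2, ?_⟩
      simp only [SetLike.mem_coe, Submodule.mem_iInf, LinearMap.mem_ker]
      intro i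
      rw [← evalAt_chord]
      exact (Submodule.mem_dualCoannihilator _).1 hf _
        ⟨_, Submodule.subset_span (Set.mem_range_self i), rfl⟩
    have hfin := Submodule.finrank_mono hle
    rw [Submodule.finrank_map_subtype_eq] at hfin
    omega

end

noncomputable section

/-- The excess of each coordinate over the maximum of the other two, if positive. -/
def excess (v : Fin 3 → ℝ) (i : Fin 3) : ℝ := max 0 (v i - max (v (i + 1)) (v (i + 2)))

lemma excess_nonneg (v : Fin 3 → ℝ) (i : Fin 3) : 0 ≤ excess v i := le_max_left _ _

lemma exists_excess_eq_zero (v : Fin 3 → ℝ) : ∃ i, ∀ i', i' ≠ i → excess v i' = 0 := by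
  obtain ⟨i, hi⟩ := Finite.exists_max v
  refine ⟨i, fun i' hii' => max_eq_left (sub_nonpos.2 ?_)⟩
  have key : ∀ i i' : Fin 3, i' ≠ i → i = i' + 1 ∨ i = i' + 2 := by decide
  rcases key i i' hii' with rfl | rfl
  · exact (hi i').trans (le_max_left _ _)
  · exact (hi i').trans (le_max_right _ _)

lemma eq_of_excess_eq {v : Fin 3 → ℝ} (h : ∀ i, excess v i = excess (-v) i) :
    v 0 = v 2 ∧ v 1 = v 2 := by
  have h0 := h 0
  have h1 := h 1
  have h2 := h 2
  have e1 : (1 : Fin 3) + 1 = 2 := rfl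
  have e2 : (1 : Fin 3) + 2 = 0 := rfl
  have e3 : (2 : Fin 3) + 1 = 0 := rfl
  have e4 : (2 : Fin 3) + 2 = 1 := rfl
  simp only [excess, Pi.neg_apply, e1, e2, e3, e4, zero_add] at h0 h1 h2
  grind

lemma continuous_excess {X : Type*} [TopologicalSpace X] {v : X → Fin 3 → ℝ} (hv : Continuous v)
    (i : Fin 3) : Continuous fun u => excess (v u) i := by
  unfold excess
  fun_prop

/-- The two classes of vertices of `K₃,₃`, read along the path carrying the gadget. -/
def vertexClass : ℕ → Fin 3 ⊕ Fin 3
  | 0 => .inr 1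
  | 1 => .inl 0
  | 2 => .inr 2
  | 3 => .inl 1
  | 4 => .inl 0
  | 5 => .inr 0
  | 6 => .inl 1
  | 7 => .inr 1
  | 8 => .inl 2
  | 9 => .inr 2
  | 10 => .inr 0
  | _ => .inl 2

/-- The node at which the edge `(i, j)` of `K₃,₃` leaves the class of `i`. -/
def srcNode : Fin 3 → Fin 3 → ℕ := ![![4, 1, 1], ![6, 6, 3], ![11, 8, 8]]

/-- The node at which the edge `(i, j)` of `K₃,₃` reaches the class of `j`. -/
def tgtNode : Fin 3 → Fin 3 → ℕ := ![![5, 0, 2], ![5, 7, 2], ![10, 7, 9]]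

lemma vertexClass_srcNode (i j : Fin 3) : vertexClass (srcNode i j) = .inl i := by
  revert i j; decide

lemma vertexClass_tgtNode (i j : Fin 3) : vertexClass (tgtNode i j) = .inr j := by
  revert i j; decide

lemma node_adjacent (i j : Fin 3) :
    srcNode i j + 1 = tgtNode i j ∨ tgtNode i j + 1 = srcNode i j := by
  revert i j; decide

lemma srcNode_lt (i j : Fin 3) : srcNode i j < 12 := by revert i j; decide

lemma tgtNode_lt (i j : Fin 3) : tgtNode i j < 12 := by revert i j; decide

/-- The edge `(i, j)` of `K₃,₃`, realised as an interval between consecutive nodes. -/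
def edge (y : ℕ → ℝ) (i j : Fin 3) (θ : ℝ) : ℝ :=
  (1 - θ) * y (srcNode i j) + θ * y (tgtNode i j)

section gadget

variable {M : Type*} [AddCommGroup M] [Module ℝ M]

/-- The map from the cone over the join of two three-point sets, induced by `γ`. -/
def halfGadget (y : ℕ → ℝ) (γ : ℝ → M) (a b : Fin 3 → ℝ) : M :=
  (∑ i, ∑ j, homog (γ ∘ edge y i j) (a i + b j) (b j)) -
    (2 : ℝ) • ∑ i, a i • γ (edge y i 0 0) - (2 : ℝ) • ∑ j, b j • γ (edge y 0 j 1)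

/-- The odd map obtained from two copies of `halfGadget`. -/
def gadget (y : ℕ → ℝ) (γ : ℝ → M) (z : Fin 4 → ℝ) : M :=
  halfGadget y γ (excess ![z 0, z 1, 0]) (excess ![z 2, z 3, 0]) -
    halfGadget y γ (excess (-![z 0, z 1, 0])) (excess (-![z 2, z 3, 0]))

/-- The difference of the total weights of the two halves of a gadget. -/
def balance (z : Fin 4 → ℝ) : ℝ :=
  (∑ i, excess ![z 0, z 1, 0] i + ∑ j, excess ![z 2, z 3, 0] j) -
    (∑ i, excess (-![z 0, z 1, 0]) i + ∑ j, excess (-![z 2, z 3, 0]) j)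

lemma map_halfGadget {M' : Type*} [AddCommGroup M'] [Module ℝ M'] (θ : M →ₗ[ℝ] M') (y : ℕ → ℝ)
    (γ : ℝ → M) (a b : Fin 3 → ℝ) :
    θ (halfGadget y γ a b) = halfGadget y (θ ∘ γ) a b := by
  simp [halfGadget, map_homog, Function.comp_assoc]

lemma map_gadget {M' : Type*} [AddCommGroup M'] [Module ℝ M'] (θ : M →ₗ[ℝ] M') (y : ℕ → ℝ)
    (γ : ℝ → M) (z : Fin 4 → ℝ) : θ (gadget y γ z) = gadget y (θ ∘ γ) z := by
  simp [gadget, map_halfGadget]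

lemma neg_vec (s t : ℝ) : ![-s, -t, 0] = -![s, t, 0] := by simp

lemma gadget_neg (y : ℕ → ℝ) (γ : ℝ → M) (z : Fin 4 → ℝ) : gadget y γ (-z) = -gadget y γ z := by
  simp only [gadget, Pi.neg_apply, neg_vec, neg_neg]
  abel

lemma balance_neg (z : Fin 4 → ℝ) : balance (-z) = -balance z := by
  simp only [balance, Pi.neg_apply, neg_vec, neg_neg]
  ring

lemma continuous_balance : Continuous balance := by
  unfold balance
  have h1 : Continuous fun z : Fin 4 → ℝ => ![z 0, z 1, 0] := by fun_prop
  have h2 : Continuous fun z : Fin 4 → ℝ => ![z 2, z 3, 0] := by fun_prop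
  exact ((continuous_finsetSum _ fun i _ => continuous_excess h1 i).add
    (continuous_finsetSum _ fun i _ => continuous_excess h2 i)).sub
    ((continuous_finsetSum _ fun i _ => continuous_excess h1.neg i).add
    (continuous_finsetSum _ fun i _ => continuous_excess h2.neg i))

lemma continuous_halfGadget {X W : Type*} [TopologicalSpace X] [NormedAddCommGroup W]
    [NormedSpace ℝ W] (y : ℕ → ℝ) {γ : ℝ → W} (hγ : Continuous γ) {a b : X → Fin 3 → ℝ}
    (ha : Continuous a) (hb : Continuous b) :
    Continuous fun u => halfGadget y γ (a u) (b u) := by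
  unfold halfGadget
  refine (Continuous.sub ?_ ?_).sub ?_
  · refine continuous_finsetSum _ fun i _ => continuous_finsetSum _ fun j _ => ?_
    have hγ' : Continuous (γ ∘ edge y i j) := hγ.comp (by unfold edge; fun_prop)
    exact (continuous_homog hγ').comp (f := fun u => (a u i + b u j, b u j)) (by fun_prop)
  · fun_prop
  · fun_prop

lemma continuous_gadget {W : Type*} [NormedAddCommGroup W] [NormedSpace ℝ W] (y : ℕ → ℝ)
    {γ : ℝ → W} (hγ : Continuous γ) : Continuous (gadget y γ) := by
  have h1 : Continuous fun z : Fin 4 → ℝ => ![z 0, z 1, 0] := by fun_prop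
  have h2 : Continuous fun z : Fin 4 → ℝ => ![z 2, z 3, 0] := by fun_prop
  have he : ∀ v : (Fin 4 → ℝ) → Fin 3 → ℝ, Continuous v → Continuous fun z => excess (v z) :=
    fun v hv => continuous_pi fun i => continuous_excess hv i
  exact (continuous_halfGadget y hγ (he _ h1) (he _ h2)).sub
    (continuous_halfGadget y hγ (he _ h1.neg) (he _ h2.neg))

lemma homog_zero_right (γ : ℝ → M) (L : ℝ) : homog γ L 0 = L • γ 0 := by
  rw [homog, zero_div, clamp_of_mem le_rfl zero_le_one]

lemma homog_self (γ : ℝ → M) (L : ℝ) : homog γ L L = L • γ 1 := by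
  rcases eq_or_ne L 0 with rfl | hL
  · simp [homog]
  · rw [homog, div_self hL, clamp_of_mem zero_le_one le_rfl]

lemma clamp_nonneg (t : ℝ) : 0 ≤ clamp t := le_max_left _ _

lemma clamp_le_one (t : ℝ) : clamp t ≤ 1 := max_le zero_le_one (min_le_right _ _)

lemma edge_zero (y : ℕ → ℝ) (i j : Fin 3) : edge y i j 0 = y (srcNode i j) := by simp [edge]

lemma edge_one (y : ℕ → ℝ) (i j : Fin 3) : edge y i j 1 = y (tgtNode i j) := by simp [edge]

lemma halfGadget_eq_smul (y : ℕ → ℝ) (γ : ℝ → M) (U U' : Fin 3 → M)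
    (hU : ∀ i j, γ (y (srcNode i j)) = U i) (hU' : ∀ i j, γ (y (tgtNode i j)) = U' j)
    {a b : Fin 3 → ℝ} {i j : Fin 3} (ha : ∀ i', i' ≠ i → a i' = 0)
    (hb : ∀ j', j' ≠ j → b j' = 0) :
    ∃ t, halfGadget y γ a b = (∑ i, a i + ∑ j, b j) • γ t := by
  refine ⟨edge y i j (clamp (b j / (a i + b j))), ?_⟩
  have hmain : homog (γ ∘ edge y i j) (a i + b j) (b j) =
    (a i + b j) • γ (edge y i j (clamp (b j / (a i + b j)))) := rfl
  have ha' : ∀ i' j', homog (γ ∘ edge y i' j') (a i') 0 = a i' • U i' := fun i' j' => by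
    rw [homog_zero_right, Function.comp, edge_zero, hU]
  have hb' : ∀ i' j', homog (γ ∘ edge y i' j') (b j') (b j') = b j' • U' j' := fun i' j' => by
    rw [homog_self, Function.comp, edge_one, hU']
  have h0 : ∀ i' j', homog (γ ∘ edge y i' j') 0 0 = 0 := fun i' j' => by simp [homog]
  unfold halfGadget
  simp only [edge_zero, edge_one, hU, hU']
  simp only [Fin.sum_univ_three]
  fin_cases i <;> fin_cases j <;> simp at ha hb <;> simp at hmain <;>
    simp [ha, hb, ha', hb', h0, hmain] <;> module

lemma halfGadget_eq_sum (y : ℕ → ℝ) (γ : ℝ → M) (U U' : Fin 3 → M)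
    (hγ : ∀ i j θ, 0 ≤ θ → θ ≤ 1 → γ (edge y i j θ) = (1 - θ) • U i + θ • U' j)
    {a b : Fin 3 → ℝ} (ha : ∀ i, 0 ≤ a i) (hb : ∀ j, 0 ≤ b j) :
    halfGadget y γ a b = ∑ i, a i • U i + ∑ j, b j • U' j := by
  have h : ∀ i j, homog (γ ∘ edge y i j) (a i + b j) (b j) = a i • U i + b j • U' j := by
    intro i j
    rcases eq_or_ne (a i + b j) 0 with h0 | h0
    · have h1 : a i = 0 := by linarith [ha i, hb j]
      have h2 : b j = 0 := by linarith [ha i, hb j]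
      simp [homog, h1, h2]
    · have hpos : 0 < a i + b j := lt_of_le_of_ne (add_nonneg (ha i) (hb j)) h0.symm
      rw [homog, Function.comp, hγ _ _ _ (clamp_nonneg _) (clamp_le_one _),
        clamp_of_mem (div_nonneg (hb j) hpos.le) (by rw [div_le_one hpos]; linarith [ha i])]
      match_scalars <;> field_simp
      ring
  have h0 : ∀ i, γ (edge y i 0 0) = U i := fun i => by
    rw [hγ _ _ _ le_rfl zero_le_one]; simp
  have h1 : ∀ j, γ (edge y 0 j 1) = U' j := fun j => by
    rw [hγ _ _ _ zero_le_one le_rfl]; simp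
  simp only [halfGadget, h, h0, h1, Fin.sum_univ_three]
  module

lemma gadget_eq_smul (y : ℕ → ℝ) (γ : ℝ → M) (U U' : Fin 3 → M)
    (hU : ∀ i j, γ (y (srcNode i j)) = U i) (hU' : ∀ i j, γ (y (tgtNode i j)) = U' j)
    {z : Fin 4 → ℝ} (hz : balance z = 0) :
    ∃ (c : ℝ) (s t : ℝ), gadget y γ z = c • (γ t - γ s) := by
  obtain ⟨i, hi⟩ := exists_excess_eq_zero ![z 0, z 1, 0]
  obtain ⟨j, hj⟩ := exists_excess_eq_zero ![z 2, z 3, 0]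
  obtain ⟨i', hi'⟩ := exists_excess_eq_zero (-![z 0, z 1, 0])
  obtain ⟨j', hj'⟩ := exists_excess_eq_zero (-![z 2, z 3, 0])
  obtain ⟨t, ht⟩ := halfGadget_eq_smul y γ U U' hU hU' hi hj
  obtain ⟨s, hs⟩ := halfGadget_eq_smul y γ U U' hU hU' hi' hj'
  exact ⟨_, s, t, by rw [gadget, ht, hs, ← sub_eq_zero.1 hz, smul_sub]⟩

lemma gadget_eq_sum (y : ℕ → ℝ) (γ : ℝ → M) (U U' : Fin 3 → M)
    (hγ : ∀ i j θ, 0 ≤ θ → θ ≤ 1 → γ (edge y i j θ) = (1 - θ) • U i + θ • U' j)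
    (z : Fin 4 → ℝ) :
    gadget y γ z = ∑ i, (excess ![z 0, z 1, 0] i - excess (-![z 0, z 1, 0]) i) • U i +
      ∑ j, (excess ![z 2, z 3, 0] j - excess (-![z 2, z 3, 0]) j) • U' j := by
  rw [gadget, halfGadget_eq_sum y γ U U' hγ (excess_nonneg _) (excess_nonneg _),
    halfGadget_eq_sum y γ U U' hγ (excess_nonneg _) (excess_nonneg _)]
  simp only [sub_smul, Finset.sum_sub_distrib]
  abel

lemma eq_zero_of_excess {z : Fin 4 → ℝ}
    (h1 : ∀ i, excess ![z 0, z 1, 0] i = excess (-![z 0, z 1, 0]) i)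
    (h2 : ∀ j, excess ![z 2, z 3, 0] j = excess (-![z 2, z 3, 0]) j) : z = 0 := by
  have h3 := eq_of_excess_eq h1
  have h4 := eq_of_excess_eq h2
  ext i
  fin_cases i
  · simpa using h3.1
  · simpa using h3.2
  · simpa using h4.1
  · simpa using h4.2

end gadget

end

noncomputable section

@[simp] lemma linearCombination_pt {M : Type*} [AddCommGroup M] [Module ℝ M] (γ : ℝ → M) (t : ℝ) :
    Finsupp.linearCombination ℝ γ (pt t) = γ t := by
  simp [pt]

@[simp] lemma linearCombination_comp_pt {M : Type*} [AddCommGroup M] [Module ℝ M] (γ : ℝ → M) :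
    Finsupp.linearCombination ℝ γ ∘ pt = γ :=
  funext fun t => linearCombination_pt γ t

lemma clamp_of_nonpos {t : ℝ} (h : t ≤ 0) : clamp t = 0 :=
  max_eq_left ((min_le_left _ _).trans h)

lemma clamp_of_one_le {t : ℝ} (h : 1 ≤ t) : clamp t = 1 := by
  rw [clamp, min_eq_right h, max_eq_right zero_le_one]

/-- The piecewise linear function taking the value `u m` at `p m` for `m ≤ M`, and constant outside
of `[p 0, p M]`. -/
def polyline (p u : ℕ → ℝ) (M : ℕ) (t : ℝ) : ℝ :=
  u 0 + ∑ m ∈ Finset.range M, (u (m + 1) - u m) * clamp ((t - p m) / (p (m + 1) - p m))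

section polyline

variable {p : ℕ → ℝ} (u : ℕ → ℝ)

lemma polyline_of_le {M : ℕ} (hp : IsCuts (M + 1) p) {t : ℝ} (ht : t ≤ p 0) :
    polyline p u M t = u 0 := by
  rw [polyline, Finset.sum_eq_zero, add_zero]
  intro m hm
  have hm := Finset.mem_range.1 hm
  rw [clamp_of_nonpos, mul_zero]
  refine div_nonpos_of_nonpos_of_nonneg ?_ ?_
  · linarith [hp.le (Nat.zero_le m) (by omega)]
  · linarith [hp.lt m (m + 1) (by omega) (by omega)]

lemma polyline_of_ge {M : ℕ} (hp : IsCuts (M + 1) p) {t : ℝ} (ht : p M ≤ t) :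
    polyline p u M t = u M := by
  induction M with
  | zero => simp [polyline]
  | succ M ih =>
    have hlt := hp.lt M (M + 1) (by omega) (by omega)
    have := ih (hp.of_le (by omega)) (by linarith)
    rw [polyline] at this ⊢
    rw [Finset.sum_range_succ, ← add_assoc, this, clamp_of_one_le]
    · ring
    · rw [le_div_iff₀ (by linarith)]
      linarith

lemma polyline_segment {M m : ℕ} (hp : IsCuts (M + 1) p) (hm : m < M) {θ : ℝ} (h0 : 0 ≤ θ)
    (h1 : θ ≤ 1) :
    polyline p u M ((1 - θ) * p m + θ * p (m + 1)) = (1 - θ) * u m + θ * u (m + 1) := by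
  induction M with
  | zero => omega
  | succ M ih =>
    have hlt := hp.lt M (M + 1) (by omega) (by omega)
    have hlt' := hp.lt m (m + 1) (by omega) (by omega)
    have hsucc : ∀ t, polyline p u (M + 1) t = polyline p u M t +
        (u (M + 1) - u M) * clamp ((t - p M) / (p (M + 1) - p M)) := fun t => by
      simp only [polyline, Finset.sum_range_succ, add_assoc]
    rw [hsucc]
    rcases (Nat.lt_succ_iff.1 hm).eq_or_lt with rfl | hm
    · rw [polyline_of_ge u (hp.of_le (by omega)) (by nlinarith)]
      have : ((1 - θ) * p m + θ * p (m + 1) - p m) / (p (m + 1) - p m) = θ := by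
        rw [div_eq_iff (by linarith)]
        ring
      rw [this, clamp_of_mem h0 h1]
      ring
    · rw [ih (hp.of_le (by omega)) hm, clamp_of_nonpos]
      · ring
      · have := hp.le (show m + 1 ≤ M by omega) (by omega)
        exact div_nonpos_of_nonpos_of_nonneg (by nlinarith) (by linarith)

end polyline

/-- The permutation of `{0, …, 5}` which pairs the nodes `2 i` and `2 (shuffle i) + 1` of equal
class. -/
def shuffle : ℕ → ℕ
  | 0 => 3
  | 1 => 4
  | 2 => 0
  | 3 => 1
  | 4 => 5
  | _ => 2

/-- `shuffle` applied in each of the first `q` blocks of length six. -/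
def partner (q j : ℕ) : ℕ := if j < 6 * q then 6 * (j / 6) + shuffle (j % 6) else j

lemma shuffle_lt : ∀ i < 6, shuffle i < 6 := by decide

lemma shuffle_inj : ∀ i < 6, ∀ j < 6, shuffle i = shuffle j → i = j := by decide

lemma vertexClass_shuffle : ∀ i < 6, vertexClass (2 * shuffle i + 1) = vertexClass (2 * i) := by
  decide

lemma eq_of_vertexClass_eq : ∀ m < 12, ∀ m' < 12, vertexClass m = vertexClass m' →
    m = m' ∨ ∃ i < 6,
      (m = 2 * i ∧ m' = 2 * shuffle i + 1) ∨ (m' = 2 * i ∧ m = 2 * shuffle i + 1) := by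
  decide

lemma partner_block {q g i : ℕ} (hg : g < q) (hi : i < 6) :
    partner q (6 * g + i) = 6 * g + shuffle i := by
  rw [partner, if_pos (by omega), show (6 * g + i) / 6 = g by omega,
    show (6 * g + i) % 6 = i by omega]

lemma partner_of_ge {q j : ℕ} (h : 6 * q ≤ j) : partner q j = j := if_neg h.not_gt

lemma partner_lt {k q j : ℕ} (hq : 6 * q ≤ k) (hj : j < k) : partner q j < k := by
  unfold partner
  have := shuffle_lt (j % 6) (Nat.mod_lt _ (by norm_num))
  split_ifs <;> omega

lemma partner_injective (q : ℕ) : Function.Injective (partner q) := by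
  intro i j h
  have hi := shuffle_lt (i % 6) (Nat.mod_lt _ (by norm_num))
  have hj := shuffle_lt (j % 6) (Nat.mod_lt _ (by norm_num))
  have := shuffle_inj (i % 6) (Nat.mod_lt _ (by norm_num)) (j % 6) (Nat.mod_lt _ (by norm_num))
  unfold partner at h
  split_ifs at h <;> omega

/-- The starting points of the first family of chords. -/
def tieStart (p : ℕ → ℝ) {k : ℕ} : Option (Fin k) → ℝ
  | none => 0
  | some j => p (2 * j)

/-- The end points of the first family of chords. -/
def tieEnd (q : ℕ) (p : ℕ → ℝ) {k : ℕ} : Option (Fin k) → ℝ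
  | none => 1
  | some j => p (2 * partner q j + 1)

/-- The formal differences of the end points of the first family of chords. -/
def tie (q : ℕ) (p : ℕ → ℝ) (k : ℕ) (o : Option (Fin k)) : ℝ →₀ ℝ :=
  pt (tieEnd q p o) - pt (tieStart p o)

/-- The span of the first family of chords. -/
def ties (q : ℕ) (p : ℕ → ℝ) (k : ℕ) : Submodule ℝ (ℝ →₀ ℝ) :=
  Submodule.span ℝ (Set.range (tie q p k))

section ties

variable {q k : ℕ} {p : ℕ → ℝ}

lemma tie_mem (o : Option (Fin k)) : tie q p k o ∈ ties q p k :=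
  Submodule.subset_span (Set.mem_range_self o)

lemma eq_zero_of_mem_ties {θ : (ℝ →₀ ℝ) →ₗ[ℝ] ℝ} (h : θ (pt 1) = θ (pt 0))
    (h' : ∀ j < k, θ (pt (p (2 * partner q j + 1))) = θ (pt (p (2 * j)))) {v : ℝ →₀ ℝ}
    (hv : v ∈ ties q p k) : θ v = 0 := by
  refine (Submodule.span_le (p := LinearMap.ker θ)).2 ?_ hv
  rintro _ ⟨_ | j, rfl⟩
  · simp [tie, tieStart, tieEnd, h]
  · simp [tie, tieStart, tieEnd, h' j j.2]

lemma cutSum_mem_ties (hq : 6 * q ≤ k) : cutSum pt k p ∈ ties q p k := by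
  have hperm : (Finset.range k).image (partner q) = Finset.range k := by
    refine Finset.eq_of_subset_of_card_le (fun i hi => ?_) ?_
    · obtain ⟨j, hj, rfl⟩ := Finset.mem_image.1 hi
      exact Finset.mem_range.2 (partner_lt hq (Finset.mem_range.1 hj))
    · rw [Finset.card_image_of_injective _ (partner_injective q)]
  have hsum : ∑ j ∈ Finset.range k, pt (p (2 * j + 1)) =
      ∑ j ∈ Finset.range k, pt (p (2 * partner q j + 1)) := by
    conv_lhs => rw [← hperm]
    exact Finset.sum_image fun i _ j _ h => partner_injective q h
  rw [cutSum, Finset.sum_sub_distrib, hsum, ← Finset.sum_sub_distrib]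
  refine Submodule.add_mem _ (tie_mem none) (Submodule.smul_mem _ _ (Submodule.sum_mem _ ?_))
  intro j hj
  rw [← neg_sub]
  exact Submodule.neg_mem _ (tie_mem (some ⟨j, Finset.mem_range.1 hj⟩))

lemma cutSum_ne_zero (hp : IsCuts (2 * k) p) : cutSum pt k p ≠ 0 := by
  intro h
  have h1 := DFunLike.congr_fun h 1
  rw [cutSum, Finsupp.add_apply, Finsupp.smul_apply, Finsupp.finsetSum_apply,
    Finset.sum_eq_zero] at h1
  · simp [pt] at h1
  · intro j hj
    have hj := Finset.mem_range.1 hj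
    simp [pt, (hp.lt_one (2 * j) (by omega)).ne, (hp.lt_one (2 * j + 1) (by omega)).ne]

lemma linearIndependent_tie (hp : IsCuts (2 * k) p) (hq : 6 * q ≤ k) :
    LinearIndependent ℝ (tie q p k) := by
  rw [Fintype.linearIndependent_iff]
  intro c hc o
  have hδ : ∀ o', tie q p k o' (tieEnd q p o) = if o' = o then 1 else 0 := by
    have hlt := fun j : Fin k => partner_lt hq j.2
    have hpos : ∀ j : Fin k, 0 < p (2 * partner q j + 1) := fun j =>
      (hp.nonneg 0 (by have := hlt j; omega)).trans_lt
        (hp.lt _ _ (by omega) (by have := hlt j; omega))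
    have h1 : ∀ j : Fin k, p (2 * partner q j + 1) ≠ 1 := fun j =>
      (hp.lt_one _ (by have := hlt j; omega)).ne
    have h1' : ∀ j : Fin k, p (2 * j) ≠ 1 := fun j => (hp.lt_one _ (by omega)).ne
    have h2 : ∀ i j : Fin k, p (2 * i) ≠ p (2 * partner q j + 1) := fun i j h => by
      have := hp.injOn (by omega) (by have := hlt j; omega) h
      omega
    have h3 : ∀ i j : Fin k, p (2 * partner q i + 1) = p (2 * partner q j + 1) ↔ i = j :=
      fun i j => ⟨fun h => Fin.ext (partner_injective q (by
        have := hp.injOn (by have := hlt i; omega) (by have := hlt j; omega) h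
        omega)), fun h => by rw [h]⟩
    intro o'
    rcases o with _ | j <;> rcases o' with _ | i <;>
      simp [tie, tieStart, tieEnd, pt, Finsupp.single_apply, h1, h1', h2, h3, (hpos _).ne,
        (h1 _).symm]
  have := DFunLike.congr_fun hc (tieEnd q p o)
  simpa only [Finsupp.finsetSum_apply, Finsupp.smul_apply, hδ, smul_eq_mul, mul_ite, mul_one,
    mul_zero, Finset.sum_ite_eq', Finset.mem_univ, if_true, Finset.sum_ite_eq,
    Finsupp.zero_apply] using this

lemma mkQ_node_eq {g : ℕ} (hg : g < q) (hq : 6 * q ≤ k) {m m' : ℕ} (hm : m < 12) (hm' : m' < 12)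
    (h : vertexClass m = vertexClass m') :
    (ties q p k).mkQ (pt (p (12 * g + m))) = (ties q p k).mkQ (pt (p (12 * g + m'))) := by
  have key : ∀ i < 6, (ties q p k).mkQ (pt (p (12 * g + (2 * shuffle i + 1)))) =
      (ties q p k).mkQ (pt (p (12 * g + 2 * i))) := by
    intro i hi
    have := tie_mem (q := q) (p := p) (k := k) (some ⟨6 * g + i, by omega⟩)
    simp only [tie, tieStart, tieEnd, partner_block hg hi] at this
    rw [show 2 * (6 * g + shuffle i) + 1 = 12 * g + (2 * shuffle i + 1) by ring,
      show 2 * (6 * g + i) = 12 * g + 2 * i by ring] at this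
    rw [← sub_eq_zero, ← map_sub]
    exact (Submodule.Quotient.mk_eq_zero _).2 this
  rcases eq_of_vertexClass_eq m hm m' hm' h with rfl | ⟨i, hi, ⟨rfl, rfl⟩ | ⟨rfl, rfl⟩⟩
  · rfl
  · exact (key i hi).symm
  · exact key i hi

lemma exists_gadget_sub_mem {g : ℕ} (hg : g < q) (hq : 6 * q ≤ k) {z : Fin 4 → ℝ}
    (hz : balance z = 0) : ∃ c s t : ℝ,
      gadget (fun m => p (12 * g + m)) pt z - c • (pt t - pt s) ∈ ties q p k := by
  obtain ⟨c, s, t, h⟩ := gadget_eq_smul (fun m => p (12 * g + m)) ((ties q p k).mkQ ∘ pt)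
    (fun i => (ties q p k).mkQ (pt (p (12 * g + srcNode i 0))))
    (fun j => (ties q p k).mkQ (pt (p (12 * g + tgtNode 0 j))))
    (fun i j => mkQ_node_eq hg hq (srcNode_lt _ _) (srcNode_lt _ _) (by simp [vertexClass_srcNode]))
    (fun i j => mkQ_node_eq hg hq (tgtNode_lt _ _) (tgtNode_lt _ _) (by simp [vertexClass_tgtNode]))
    hz
  refine ⟨c, s, t, (Submodule.Quotient.mk_eq_zero _).1 ?_⟩
  change (ties q p k).mkQ _ = 0
  rw [map_sub, map_gadget, h]
  simp

end ties

end

noncomputable section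

/-- The last of the cuts `p 0, …, p (2 k - 1)`, or `0` if there are none. -/
def lastCut (p : ℕ → ℝ) (k : ℕ) : ℝ := if k = 0 then 0 else p (2 * k - 1)

/-- The combination of a circle and of `q` gadgets carried by consecutive blocks of twelve nodes. -/
def assembly {M : Type*} [AddCommGroup M] [Module ℝ M] {q : ℕ} (p : ℕ → ℝ) (γ : ℝ → M) {m : ℕ}
    (x : Fin m → ℝ) (z : Fin q → Fin 4 → ℝ) : M :=
  circle γ x + ∑ g : Fin q, gadget (fun m => p (12 * g + m)) γ (z g)

section assembly

variable {q k : ℕ} {p : ℕ → ℝ}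

lemma le_lastCut (hp : IsCuts (2 * k) p) {m : ℕ} (hm : m < 2 * k) : p m ≤ lastCut p k := by
  rw [lastCut, if_neg (by omega)]
  exact hp.le (by omega) (by omega)

lemma lastCut_nonneg (hp : IsCuts (2 * k) p) : 0 ≤ lastCut p k := by
  unfold lastCut
  split_ifs
  · exact le_rfl
  · exact hp.nonneg _ (by omega)

lemma lastCut_lt_one (hp : IsCuts (2 * k) p) : lastCut p k < 1 := by
  unfold lastCut
  split_ifs
  · exact zero_lt_one
  · exact hp.lt_one _ (by omega)

lemma edge_le_lastCut (hp : IsCuts (2 * k) p) (hq : 6 * q ≤ k) {g : ℕ} (hg : g < q) (i j : Fin 3)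
    {θ : ℝ} (h0 : 0 ≤ θ) (h1 : θ ≤ 1) :
    edge (fun m => p (12 * g + m)) i j θ ≤ lastCut p k := by
  have hs := le_lastCut hp (m := 12 * g + srcNode i j) (by have := srcNode_lt i j; omega)
  have ht := le_lastCut hp (m := 12 * g + tgtNode i j) (by have := tgtNode_lt i j; omega)
  unfold edge
  nlinarith

lemma exists_circle_apply_ne_zero (hp : IsCuts (2 * k) p) {r : ℕ} {x : Fin (2 * r + 1) → ℝ}
    (hx : x ≠ 0) (h : circle (fun t => max 0 (t - lastCut p k)) x = 0) :
    ∃ s, lastCut p k < s ∧ s < 1 ∧ circle pt x s ≠ 0 := by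
  obtain ⟨r', -, p', hp', c, hc, heq⟩ := circle_eq_cutSum pt hx
  obtain ⟨l, hl, hlast⟩ : ∃ l < 2 * r', lastCut p k < p' l := by
    by_contra! hle
    have h1 : circle (fun t => max 0 (t - lastCut p k)) x = c * (1 - lastCut p k) := by
      rw [← linearCombination_comp_pt fun t => max 0 (t - lastCut p k), ← map_circle, heq]
      have h0 := max_eq_left (sub_nonpos.2 (lastCut_nonneg hp))
      have h1 := max_eq_right (sub_pos.2 (lastCut_lt_one hp)).le
      simp only [cutSum, map_smul, map_add, map_sub, map_sum, linearCombination_pt, h0, h1]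
      rw [Finset.sum_eq_zero]
      · simp
      · intro j hj
        have hj := Finset.mem_range.1 hj
        rw [max_eq_left (sub_nonpos.2 (hle _ (by omega))),
          max_eq_left (sub_nonpos.2 (hle _ (by omega))), sub_zero]
    exact mul_ne_zero hc (sub_pos.2 (lastCut_lt_one hp)).ne' (h1.symm.trans h)
  refine ⟨p' l, hlast, hp'.lt_one l hl, ?_⟩
  have hpos := (lastCut_nonneg hp).trans_lt hlast
  have happ : ∀ m < 2 * r', pt (p' m) (p' l) = if m = l then 1 else 0 := by
    intro m hm
    rw [pt, Finsupp.single_apply]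
    exact if_congr ⟨hp'.injOn hm hl, fun h => by rw [h]⟩ rfl rfl
  have h1 : pt 1 (p' l) = 0 := by simp [pt, (hp'.lt_one l hl).ne]
  have h0 : pt 0 (p' l) = 0 := by simp [pt, hpos.ne']
  rw [heq, Finsupp.smul_apply, cutSum, Finsupp.add_apply, Finsupp.sub_apply, h1, h0,
    Finsupp.smul_apply, Finsupp.finsetSum_apply, Finset.sum_eq_single (l / 2)]
  · rw [Finsupp.sub_apply, happ _ (by omega), happ _ (by omega)]
    rcases Nat.even_or_odd' l with ⟨i, rfl | rfl⟩
    · simp [hc]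
    · rw [show (2 * i + 1) / 2 = i by omega]
      simp [hc]
  · intro j hj hjl
    have hj := Finset.mem_range.1 hj
    rw [Finsupp.sub_apply, happ _ (by omega), happ _ (by omega), if_neg (by omega),
      if_neg (by omega), sub_zero]
  · intro hl'
    exact absurd (Finset.mem_range.2 (by omega)) hl'

lemma gadget_apply_eq_zero (hp : IsCuts (2 * k) p) (hq : 6 * q ≤ k) {g : ℕ} (hg : g < q)
    (z : Fin 4 → ℝ) {s : ℝ} (hs : lastCut p k < s) :
    gadget (fun m => p (12 * g + m)) pt z s = 0 := by
  rw [← Finsupp.lapply_apply (R := ℝ)]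
  rw [map_gadget, gadget_eq_sum _ _ 0 0]
  · simp
  · intro i j θ h0 h1
    simp [pt, ((edge_le_lastCut hp hq hg i j h0 h1).trans_lt hs).ne']

lemma apply_eq_zero_of_mem_ties (hp : IsCuts (2 * k) p) (hq : 6 * q ≤ k) {v : ℝ →₀ ℝ}
    (hv : v ∈ ties q p k) {s : ℝ} (hs : lastCut p k < s) (hs1 : s < 1) : v s = 0 := by
  have h : ∀ m < 2 * k, pt (p m) s = 0 := fun m hm => by
    simp [pt, ((le_lastCut hp hm).trans_lt hs).ne']
  refine eq_zero_of_mem_ties (θ := Finsupp.lapply s) ?_ (fun j hj => ?_) hv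
  · simp [pt, hs1.ne, ((lastCut_nonneg hp).trans_lt hs).ne']
  · have := partner_lt hq hj
    rw [Finsupp.lapply_apply, Finsupp.lapply_apply, h _ (by omega), h _ (by omega)]

/-- The node values prescribed by `C` on the classes of the `q` blocks. -/
def nodeValue (q : ℕ) (C : ℕ → Fin 3 ⊕ Fin 3 → ℝ) (m : ℕ) : ℝ :=
  if m < 12 * q then C (m / 12) (vertexClass (m % 12)) else 0

/-- The function interpolating `nodeValue`, closed up to a loop. -/
def interpolant (q : ℕ) (p : ℕ → ℝ) (k : ℕ) (C : ℕ → Fin 3 ⊕ Fin 3 → ℝ) (t : ℝ) : ℝ :=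
  if t ≤ lastCut p k then polyline p (nodeValue q C) (2 * k - 1) t else nodeValue q C 0

variable (C : ℕ → Fin 3 ⊕ Fin 3 → ℝ)

lemma nodeValue_block {g m : ℕ} (hg : g < q) (hm : m < 12) :
    nodeValue q C (12 * g + m) = C g (vertexClass m) := by
  rw [nodeValue, if_pos (by omega), show (12 * g + m) / 12 = g by omega,
    show (12 * g + m) % 12 = m by omega]

lemma nodeValue_partner (j : ℕ) :
    nodeValue q C (2 * partner q j + 1) = nodeValue q C (2 * j) := by
  by_cases hj : j < 6 * q
  · have hi : j % 6 < 6 := Nat.mod_lt _ (by norm_num)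
    have hg : j / 6 < q := by omega
    have hs := shuffle_lt _ hi
    have hj' : j = 6 * (j / 6) + j % 6 := (Nat.div_add_mod j 6).symm
    have h1 := partner_block hg hi
    rw [← hj'] at h1
    rw [h1, show 2 * (6 * (j / 6) + shuffle (j % 6)) + 1 =
        12 * (j / 6) + (2 * shuffle (j % 6) + 1) by ring, nodeValue_block C hg (by omega),
      vertexClass_shuffle _ hi, ← nodeValue_block C hg (by omega)]
    congr 1
    omega
  · rw [partner_of_ge (by omega), nodeValue, nodeValue, if_neg (by omega), if_neg (by omega)]

lemma interpolant_node (hp : IsCuts (2 * k) p) {m : ℕ} (hm : m < 2 * k) :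
    interpolant q p k C (p m) = nodeValue q C m := by
  have hp' : IsCuts (2 * k - 1 + 1) p := hp.of_le (by omega)
  rw [interpolant, if_pos (le_lastCut hp hm)]
  rcases (show m ≤ 2 * k - 1 by omega).eq_or_lt with rfl | hm'
  · exact polyline_of_ge _ hp' le_rfl
  · simpa using polyline_segment (nodeValue q C) hp' hm' le_rfl zero_le_one

lemma interpolant_zero (hp : IsCuts (2 * k) p) (hk : 0 < k) :
    interpolant q p k C 0 = nodeValue q C 0 := by
  rw [interpolant, if_pos (lastCut_nonneg hp)]
  exact polyline_of_le _ (hp.of_le (by omega)) (hp.nonneg 0 (by omega))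

lemma interpolant_one (hp : IsCuts (2 * k) p) : interpolant q p k C 1 = nodeValue q C 0 :=
  if_neg (lastCut_lt_one hp).not_ge

lemma interpolant_edge (hp : IsCuts (2 * k) p) (hq : 6 * q ≤ k) {g : ℕ} (hg : g < q) (i j : Fin 3)
    {θ : ℝ} (h0 : 0 ≤ θ) (h1 : θ ≤ 1) :
    interpolant q p k C (edge (fun m => p (12 * g + m)) i j θ) =
      (1 - θ) • C g (.inl i) + θ • C g (.inr j) := by
  have hs := srcNode_lt i j
  have ht := tgtNode_lt i j
  have hp' : IsCuts (2 * k - 1 + 1) p := hp.of_le (by omega)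
  rw [interpolant, if_pos (edge_le_lastCut hp hq hg i j h0 h1), edge, ← vertexClass_srcNode i j,
    ← vertexClass_tgtNode i j, ← nodeValue_block C hg hs, ← nodeValue_block C hg ht, smul_eq_mul,
    smul_eq_mul]
  rcases node_adjacent i j with h | h
  · rw [← h, ← add_assoc]
    exact polyline_segment _ hp' (by omega) h0 h1
  · rw [← h, ← add_assoc]
    have := polyline_segment (nodeValue q C) hp' (m := 12 * g + tgtNode i j) (by omega)
      (sub_nonneg.2 h1) (sub_le_self 1 h0)
    rw [sub_sub_cancel] at this
    rw [add_comm, this, add_comm]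

lemma eq_zero_of_sum_gadget_mem (hp : IsCuts (2 * k) p) (hq : 6 * q ≤ k)
    {z : Fin q → Fin 4 → ℝ}
    (h : ∑ g : Fin q, gadget (fun m => p (12 * g + m)) pt (z g) ∈ ties q p k) : z = 0 := by
  have key : ∀ C : ℕ → Fin 3 ⊕ Fin 3 → ℝ, ∑ g : Fin q,
      (∑ i, (excess ![z g 0, z g 1, 0] i - excess (-![z g 0, z g 1, 0]) i) • C g (.inl i) +
      ∑ j, (excess ![z g 2, z g 3, 0] j - excess (-![z g 2, z g 3, 0]) j) • C g (.inr j)) = 0 := by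
    intro C
    rcases Nat.eq_zero_or_pos q with rfl | hq0
    · simp
    have h0 : Finsupp.linearCombination ℝ (interpolant q p k C)
        (∑ g : Fin q, gadget (fun m => p (12 * g + m)) pt (z g)) = 0 := by
      refine eq_zero_of_mem_ties ?_ (fun j hj => ?_) h
      · rw [linearCombination_pt, linearCombination_pt, interpolant_one C hp,
          interpolant_zero C hp (by omega)]
      · have := partner_lt hq hj
        rw [linearCombination_pt, linearCombination_pt, interpolant_node C hp (by omega),
          interpolant_node C hp (by omega), nodeValue_partner]
    rw [map_sum] at h0
    refine (Finset.sum_congr rfl fun g _ => ?_).trans h0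
    rw [map_gadget, linearCombination_comp_pt]
    exact (gadget_eq_sum _ _ (fun i => C g (.inl i)) (fun j => C g (.inr j))
      (fun i j θ h0 h1 => interpolant_edge C hp hq g.2 i j h0 h1) _).symm
  ext1 g
  refine eq_zero_of_excess (fun i => ?_) (fun j => ?_)
  · have := key fun g' c => if g' = g ∧ c = .inl i then 1 else 0
    simpa [ite_and, Fin.val_inj, sub_eq_zero] using this
  · have := key fun g' c => if g' = g ∧ c = .inr j then 1 else 0
    simpa [ite_and, Fin.val_inj, sub_eq_zero] using this

lemma map_assembly {M M' : Type*} [AddCommGroup M] [Module ℝ M] [AddCommGroup M'] [Module ℝ M']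
    (θ : M →ₗ[ℝ] M') (γ : ℝ → M) {m : ℕ} (x : Fin m → ℝ) (z : Fin q → Fin 4 → ℝ) :
    θ (assembly p γ x z) = assembly p (θ ∘ γ) x z := by
  simp [assembly, map_circle, map_gadget]

lemma assembly_neg {M : Type*} [AddCommGroup M] [Module ℝ M] (γ : ℝ → M) {m : ℕ}
    (x : Fin m → ℝ) (z : Fin q → Fin 4 → ℝ) :
    assembly p γ (-x) (-z) = -assembly p γ x z := by
  simp only [assembly, circle_neg, Pi.neg_apply, gadget_neg, Finset.sum_neg_distrib]
  abel

lemma continuous_assembly {W : Type*} [NormedAddCommGroup W] [NormedSpace ℝ W] {γ : ℝ → W}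
    (hγ : Continuous γ) (m : ℕ) :
    Continuous fun u : (Fin m → ℝ) × (Fin q → Fin 4 → ℝ) => assembly p γ u.1 u.2 :=
  ((continuous_circle hγ m).comp continuous_fst).add <| continuous_finsetSum _ fun g _ =>
    (continuous_gadget _ hγ).comp ((continuous_apply g).comp continuous_snd)

lemma eq_zero_of_assembly_mem (hp : IsCuts (2 * k) p) (hq : 6 * q ≤ k) {r : ℕ}
    {x : Fin (2 * r + 1) → ℝ} {z : Fin q → Fin 4 → ℝ}
    (hx : circle (fun t => max 0 (t - lastCut p k)) x = 0)
    (h : assembly p pt x z ∈ ties q p k) : x = 0 ∧ z = 0 := by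
  have hx0 : x = 0 := by
    by_contra hne
    obtain ⟨s, hs, hs1, hne⟩ := exists_circle_apply_ne_zero hp hne hx
    refine hne ?_
    rw [← apply_eq_zero_of_mem_ties hp hq h hs hs1, assembly, Finsupp.add_apply,
      Finsupp.finsetSum_apply, Finset.sum_eq_zero, add_zero]
    exact fun g _ => gadget_apply_eq_zero hp hq g.2 _ hs
  refine ⟨hx0, eq_zero_of_sum_gadget_mem hp hq ?_⟩
  simpa [assembly, hx0] using h

lemma exists_chords_circle {r : ℕ} (x : Fin (2 * r + 1) → ℝ) : ∃ a b : Fin r → ℝ,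
    circle pt x ∈ Submodule.span ℝ ({pt 1 - pt 0} ∪ Set.range fun i => pt (b i) - pt (a i)) := by
  rcases eq_or_ne x 0 with rfl | hx
  · exact ⟨0, 0, by simp⟩
  · obtain ⟨r', hr, p', -, c, -, h⟩ := circle_eq_cutSum pt hx
    refine ⟨fun i => p' (2 * i + 1), fun i => p' (2 * i), ?_⟩
    rw [h, cutSum]
    refine Submodule.smul_mem _ _ (Submodule.add_mem _ ?_ (Submodule.smul_mem _ _
      (Submodule.sum_mem _ fun j hj => ?_)))
    · exact Submodule.subset_span (Or.inl rfl)
    · exact Submodule.subset_span (Or.inr ⟨⟨j, (Finset.mem_range.1 hj).trans_le hr⟩, rfl⟩)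

lemma exists_chords_assembly (hq : 6 * q ≤ k) {r : ℕ} (x : Fin (2 * r + 1) → ℝ)
    {z : Fin q → Fin 4 → ℝ} (hz : ∀ g, balance (z g) = 0) :
    ∃ a b : Option (Fin k) ⊕ (Fin r ⊕ Fin q) → ℝ,
      ties q p k ≤ Submodule.span ℝ (Set.range fun i => pt (b i) - pt (a i)) ∧
      assembly p pt x z ∈ Submodule.span ℝ (Set.range fun i => pt (b i) - pt (a i)) := by
  obtain ⟨a, b, hab⟩ := exists_chords_circle x
  choose c s t hg using fun g : Fin q => exists_gadget_sub_mem (p := p) g.2 hq (hz g)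
  let a' := Sum.elim (tieStart p (k := k)) (Sum.elim a s)
  let b' := Sum.elim (tieEnd q p (k := k)) (Sum.elim b t)
  have hmem : ∀ i, pt (b' i) - pt (a' i) ∈
      Submodule.span ℝ (Set.range fun i => pt (b' i) - pt (a' i)) := fun i =>
    Submodule.subset_span (Set.mem_range_self i)
  have hties : ties q p k ≤ Submodule.span ℝ (Set.range fun i => pt (b' i) - pt (a' i)) := by
    refine Submodule.span_le.2 ?_
    rintro _ ⟨o, rfl⟩
    exact hmem (.inl o)
  refine ⟨a', b', hties, Submodule.add_mem _ ?_ (Submodule.sum_mem _ fun g _ => ?_)⟩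
  · refine Submodule.span_le.2 ?_ hab
    rintro _ (rfl | ⟨i, rfl⟩)
    · exact hmem (.inl none)
    · exact hmem (.inr (.inl i))
  · have := Submodule.add_mem _ (hties (hg g))
      (Submodule.smul_mem _ (c g) (hmem (.inr (.inr g))))
    simpa [a', b'] using this

end assembly

end

noncomputable section

lemma exists_pair_of_finrank_map {K V W : Type*} [Field K] [AddCommGroup V] [Module K V]
    [AddCommGroup W] [Module K W] (g : V →ₗ[K] W) (X : Submodule K V) [FiniteDimensional K X]
    (h : Module.finrank K (X.map g) + 2 ≤ Module.finrank K X) :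
    ∃ ν : Fin 2 → V, LinearIndependent K ν ∧ (∀ j, ν j ∈ X) ∧ ∀ j, g (ν j) = 0 := by
  have hrank := (g ∘ₗ X.subtype).finrank_range_add_finrank_ker
  rw [LinearMap.range_comp, Submodule.range_subtype] at hrank
  obtain ⟨ν, hν⟩ := exists_linearIndependent_of_le_finrank
    (show 2 ≤ Module.finrank K (LinearMap.ker (g ∘ₗ X.subtype)) by omega)
  refine ⟨fun j => (ν j : X), ?_, fun j => (ν j : X).2, fun j => (ν j).2⟩
  exact hν.map' (X.subtype ∘ₗ (LinearMap.ker (g ∘ₗ X.subtype)).subtype)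
    (LinearMap.ker_eq_bot.2 (X.injective_subtype.comp (Submodule.injective_subtype _)))

lemma exists_linearMap_ker {K W : Type*} [Field K] [AddCommGroup W] [Module K W]
    [FiniteDimensional K W] (Y : Submodule K W) :
    ∃ ρ : W →ₗ[K] Fin (Module.finrank K W - Module.finrank K Y) → K, LinearMap.ker ρ = Y := by
  have h := Y.finrank_quotient_add_finrank
  let e : (W ⧸ Y) ≃ₗ[K] (Fin (Module.finrank K W - Module.finrank K Y) → K) :=
    LinearEquiv.ofFinrankEq _ _ (by rw [Module.finrank_fin_fun]; omega)
  exact ⟨e.toLinearMap ∘ₗ Y.mkQ, by rw [LinearEquiv.ker_comp, Submodule.ker_mkQ]⟩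

section zeros

variable {W : Type*} [NormedAddCommGroup W] [NormedSpace ℝ W] [FiniteDimensional ℝ W]

lemma exists_circle_eq_zero {φ : ℝ → W} (hφ : Continuous φ) {m : ℕ}
    (h : Module.finrank ℝ W < m) : ∃ x : Fin m → ℝ, x ≠ 0 ∧ circle φ x = 0 :=
  BorsukUlam.exists_zero (by rwa [Module.finrank_fin_fun]) _ (continuous_circle hφ m) (circle_neg φ)

lemma exists_assembly_eq_zero {φ : ℝ → W} (hφ : Continuous φ) {ψ : ℝ → ℝ} (hψ : Continuous ψ)
    (p : ℕ → ℝ) {m q : ℕ} (h : Module.finrank ℝ W + 1 < m + 3 * q) :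
    ∃ (x : Fin m → ℝ) (z : Fin q → Fin 4 → ℝ), ¬ (x = 0 ∧ z = 0) ∧ assembly p φ x z = 0 ∧
      circle ψ x = 0 ∧ ∀ g, balance (z g) = 0 := by
  obtain ⟨⟨x, z⟩, hne, h0⟩ := BorsukUlam.exists_zero
    (V := (Fin m → ℝ) × (Fin q → Fin 4 → ℝ)) (W := W × ℝ × (Fin q → ℝ))
    (by simp [Module.finrank_pi_fintype]; omega)
    (fun u => (assembly p φ u.1 u.2, circle ψ u.1, fun g => balance (u.2 g)))
    ((continuous_assembly hφ m).prodMk (((continuous_circle hψ m).comp continuous_fst).prodMk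
      (continuous_pi fun g => continuous_balance.comp ((continuous_apply g).comp continuous_snd))))
    (fun u => by
      simp only [Prod.fst_neg, Prod.snd_neg, assembly_neg, circle_neg, Pi.neg_apply, balance_neg]
      rfl)
  simp only [ne_eq, Prod.mk_eq_zero] at hne h0
  exact ⟨x, z, hne, h0.1, h0.2.1, congr_fun h0.2.2⟩

/-- A continuous path in `W` admits few chords whose differences, taken formally, satisfy two
independent linear relations along the path. -/
theorem exists_two_relations {φ : ℝ → W} (hφ : Continuous φ) {n r₀ : ℕ}
    (hr₀ : Module.finrank ℝ W ≤ 2 * r₀)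
    (hn : ∀ k ≤ r₀, k + 1 ≤ n ∧ ∃ q, 6 * q ≤ k ∧ q + k + 1 ≤ n ∧
      Module.finrank ℝ W + k + 3 ≤ 2 * n + q) :
    ∃ (ι : Type) (_ : Fintype ι) (a b : ι → ℝ) (ν : Fin 2 → ℝ →₀ ℝ), Fintype.card ι ≤ n ∧
      LinearIndependent ℝ ν ∧
      (∀ j, ν j ∈ Submodule.span ℝ (Set.range fun i => pt (b i) - pt (a i))) ∧
      ∀ j, Finsupp.linearCombination ℝ φ (ν j) = 0 := by
  obtain ⟨x₁, hx₁, hzero⟩ := exists_circle_eq_zero hφ (m := 2 * r₀ + 1) (by omega)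
  obtain ⟨k, hk, p, hp, c, hc, heq⟩ := circle_eq_cutSum pt hx₁
  obtain ⟨hkn, q, hq, hqn, hN⟩ := hn k hk
  have hν₁ : Finsupp.linearCombination ℝ φ (cutSum pt k p) = 0 := by
    have := map_circle (Finsupp.linearCombination ℝ φ) pt x₁
    rw [linearCombination_comp_pt, hzero, heq, map_smul] at this
    exact (smul_eq_zero.1 this).resolve_left hc
  have : FiniteDimensional ℝ (ties q p k) := FiniteDimensional.span_of_finite ℝ (Set.finite_range _)
  have hties : Module.finrank ℝ (ties q p k) = k + 1 := by
    rw [ties, finrank_span_eq_card (linearIndependent_tie hp hq), Fintype.card_option,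
      Fintype.card_fin]
  set Y := (ties q p k).map (Finsupp.linearCombination ℝ φ) with hY
  by_cases hrank : k ≤ Module.finrank ℝ Y
  · obtain ⟨ρ, hρ⟩ := exists_linearMap_ker Y
    obtain ⟨x, z, hne, h1, h2, h3⟩ := exists_assembly_eq_zero
      ((LinearMap.continuous_of_finiteDimensional ρ).comp hφ)
      (ψ := fun t => max 0 (t - lastCut p k)) (by fun_prop) p
      (m := 2 * (n - k - 1 - q) + 1) (q := q)
      (by
        have := Y.finrank_le
        rw [Module.finrank_fin_fun]
        omega)
    have hY' : Finsupp.linearCombination ℝ φ (assembly p pt x z) ∈ Y := by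
      rw [← hρ, LinearMap.mem_ker, map_assembly, map_assembly, linearCombination_comp_pt, h1]
    obtain ⟨σ, hσ, hσ'⟩ := hY'
    obtain ⟨a, b, hab, hmem⟩ := exists_chords_assembly (p := p) hq x h3
    refine ⟨_, inferInstance, a, b, ![cutSum pt k p, assembly p pt x z - σ], ?_, ?_, ?_, ?_⟩
    · simp
      omega
    · rw [LinearIndependent.pair_iff' (cutSum_ne_zero hp)]
      intro s hs
      refine hne (eq_zero_of_assembly_mem hp hq h2 ?_)
      rw [← sub_add_cancel (assembly p pt x z) σ, ← hs]
      exact Submodule.add_mem _ (Submodule.smul_mem _ _ (cutSum_mem_ties hq)) hσ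
    · rw [Fin.forall_fin_two]
      exact ⟨hab (cutSum_mem_ties hq), Submodule.sub_mem _ hmem (hab hσ)⟩
    · rw [Fin.forall_fin_two]
      refine ⟨hν₁, ?_⟩
      simp only [Matrix.cons_val_one, Matrix.cons_val_zero]
      rw [map_sub, hσ', sub_self]
  · obtain ⟨ν, hν, hmem, hker⟩ := exists_pair_of_finrank_map (Finsupp.linearCombination ℝ φ)
      (ties q p k) (by rw [← hY]; omega)
    exact ⟨Option (Fin k), inferInstance, tieStart p, tieEnd q p, ν, by simpa using hkn, hν, hmem,
      hker⟩

end zeros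

lemma evalAt_eq_zero_of_basis {F : Submodule ℝ C(ℝ, ℝ)} {N : ℕ} (e : Module.Basis (Fin N) ℝ F)
    {ν : ℝ →₀ ℝ}
    (h : Finsupp.linearCombination ℝ (fun t i => (e i : C(ℝ, ℝ)) t) ν = 0) (f : C(ℝ, ℝ))
    (hf : f ∈ F) : evalAt ν f = 0 := by
  have hi : ∀ i, evalAt ν (e i) = 0 := by
    intro i
    have := congr_fun h i
    rw [Finsupp.linearCombination_apply, Finsupp.sum, Finset.sum_apply] at this
    rw [evalAt, Finsupp.linearCombination_apply, Finsupp.sum, LinearMap.sum_apply]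
    exact this
  have hf' : ((∑ i, e.repr ⟨f, hf⟩ i • e i : F) : C(ℝ, ℝ)) = f :=
    congr_arg Subtype.val (e.sum_repr ⟨f, hf⟩)
  rw [← hf', Submodule.coe_sum, map_sum]
  exact Finset.sum_eq_zero fun i _ => by rw [Submodule.coe_smul, map_smul, hi, smul_zero]

end

end ChordDiagram

/-- Degeneration by at least 2: under the listed conditions on (n, N), every
N-dimensional subspace of C(ℝ, ℝ) admits a non-resonant n-chord diagram whose
conditions cut out a subspace of codimension at most n - 2. -/
theorem stmt4 (n N : ℕ) (hnN : n ≤ N)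
    (h : (6 ≤ n ∧ N = n) ∨ (10 ≤ n ∧ N ≤ n + 1) ∨ (14 ≤ n ∧ N ≤ n + 3) ∨
         (16 ≤ n ∧ N ≤ n + 4) ∨ (18 ≤ n ∧ N ≤ n + 5) ∨ (26 ≤ n ∧ N ≤ n + 6))
    (F : Submodule ℝ C(ℝ, ℝ)) [FiniteDimensional ℝ F]
    (hF : Module.finrank ℝ F = N) :
    ∃ a b : Fin n → ℝ,
      (∀ i, a i < b i) ∧
      Function.Injective (fun i => (a i, b i)) ∧
      LinearIndependent ℝ (fun i => evalDiff (a i) (b i)) ∧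
      (N : ℤ) - n + 2 ≤
        Module.finrank ℝ ↥(F ⊓ ⨅ i, LinearMap.ker (evalDiff (a i) (b i))) := by
  let e := Module.finBasisOfFinrankEq ℝ F hF
  obtain ⟨ι, _, a, b, ν, hι, hν, hspan, hker⟩ := ChordDiagram.exists_two_relations
    (φ := fun t i => (e i : C(ℝ, ℝ)) t) (by fun_prop) (n := n) (r₀ := (N + 1) / 2)
    (by rw [Module.finrank_fin_fun]; omega) fun k hk =>
      ⟨by omega, N + k + 3 - 2 * n, by omega, by omega, by rw [Module.finrank_fin_fun]; omega⟩
  exact ChordDiagram.exists_diagram (by omega) hF hι a b ν hν hspan fun j f hf =>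
    ChordDiagram.evalAt_eq_zero_of_basis e (hker j) f hf
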